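/- arXiv:0704.0416 — 5 statements merged into one kernel-verified Lean document; each statement's English description precedes it below -/
import Mathlib

section
/- The Veech group Γ(U_D) of the origami D is not a congruence subgroup of SL₂(ℤ). -/
/-- The free group on two generators. -/
abbrev F2 := FreeGroup (Fin 2)

/-- The generator `x` of `F₂`. -/
def xg : F2 := FreeGroup.of 0

/-- The generator `y` of `F₂`. -/
def yg : F2 := FreeGroup.of 1

/-- The exponent sum of the `i`-th generator, i.e. the `i`-th coordinate of the image in the
abelianization `ℤ²` of `F₂`. -/
def expSum (i : Fin 2) : F2 →* Multiplicative ℤ :=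
  FreeGroup.lift fun j => Multiplicative.ofAdd (if j = i then (1 : ℤ) else 0)

/-- The matrix in `GL₂(ℤ)` induced by an automorphism `γ` of `F₂` on the abelianization
`F₂^ab ≅ ℤ²` (with basis the images of `x` and `y`); i.e. `β̂(γ)`. -/
def autMat (γ : F2 ≃* F2) : Matrix (Fin 2) (Fin 2) ℤ :=
  Matrix.of fun i j => Multiplicative.toAdd (expSum i (γ (FreeGroup.of j)))

abbrev SL2Z := Matrix.SpecialLinearGroup (Fin 2) ℤ

/-- `Stab(V) = {γ ∈ Aut⁺(F₂) : γ(V) = V}`. -/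
def StabSet (V : Subgroup F2) : Set (F2 ≃* F2) :=
  { γ | (autMat γ).det = 1 ∧ Subgroup.map γ.toMonoidHom V = V }

/-- The Veech group `Γ(V) = β̂(Stab(V)) ⊆ SL₂(ℤ)` of a subgroup `V` of `F₂`. -/
def VeechGroup (V : Subgroup F2) : Set SL2Z :=
  { A | ∃ γ : F2 ≃* F2, γ ∈ StabSet V ∧ (A : Matrix (Fin 2) (Fin 2) ℤ) = autMat γ }

/-- A set of elements of `SL₂(ℤ)` is a congruence group if it contains the principal congruence
subgroup `Γ(n)` for some `n ≥ 1`. -/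
def IsCongruenceSet (S : Set SL2Z) : Prop :=
  ∃ n : ℕ, 1 ≤ n ∧ (CongruenceSubgroup.Gamma n : Set SL2Z) ⊆ S

/-- The subgroup of `Multiplicative ℤ` of elements divisible by `n`. -/
def divSub (n : ℤ) : Subgroup (Multiplicative ℤ) where
  carrier := {d | n ∣ Multiplicative.toAdd d}
  one_mem' := dvd_zero n
  mul_mem' := fun ha hb => dvd_add ha hb
  inv_mem' := fun ha => dvd_neg.mpr ha

/-- The subgroup `Hₙ = {u ∈ U : n ∣ α(u)}` of `F₂` (for `n = 0` this is `ker α = H₀`). -/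
def Hgrp {U : Subgroup F2} (α : U →* Multiplicative ℤ) (n : ℕ) : Subgroup F2 :=
  Subgroup.map U.subtype (Subgroup.comap α (divSub (n : ℤ)))

/-- The subgroup `U_L` of `F₂` corresponding to the origami `L(2,3)`. -/
def UL : Subgroup F2 :=
  Subgroup.closure {xg ^ 3, xg * yg * xg⁻¹, xg ^ 2 * yg * (xg ^ 2)⁻¹, yg * xg * yg⁻¹, yg ^ 2}

/-- The subgroup `U_D` of `F₂` corresponding to the origami `D`. -/
def UD : Subgroup F2 :=
  Subgroup.closure {xg ^ 3, xg * yg * (xg ^ 2)⁻¹, xg ^ 2 * yg * xg⁻¹, yg * xg * yg⁻¹,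
    yg ^ 2 * xg * (yg ^ 2)⁻¹, yg ^ 3}

namespace FreeGroup

/-- The length of the longest common prefix of two lists. -/
def lcp {β : Type*} [DecidableEq β] : List β → List β → ℕ
  | a :: l, b :: m => if a = b then lcp l m + 1 else 0
  | _, _ => 0

theorem le_lcp {β : Type*} [DecidableEq β] {k : ℕ} {l m : List β} :
    k ≤ lcp l m ↔ l.take k = m.take k ∧ k ≤ l.length ∧ k ≤ m.length := by
  induction l generalizing k m with
  | nil => cases m <;> simp +contextual [lcp]
  | cons a l ih =>
    cases m with
    | nil => simp +contextual [lcp]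
    | cons b m =>
      cases k with
      | zero => simp
      | succ k =>
        by_cases h : a = b
        · simp [lcp, h, ih]
        · simp [lcp, h]

theorem exists_eq_append_lcp {β : Type*} [DecidableEq β] (l m : List β) :
    ∃ p A B, l = p ++ A ∧ m = p ++ B ∧ p.length = lcp l m ∧
      ∀ a ∈ A.head?, ∀ b ∈ B.head?, a ≠ b := by
  induction l generalizing m with
  | nil => exact ⟨[], [], m, by simp [lcp]⟩
  | cons a l ih =>
    cases m with
    | nil => exact ⟨[], a :: l, [], by simp [lcp]⟩
    | cons b m =>
      by_cases h : a = b
      · obtain ⟨p, A, B, rfl, rfl, h1, h2⟩ := ih m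
        exact ⟨a :: p, A, B, by simp, by simp [h], by simp [lcp, h, h1], h2⟩
      · exact ⟨[], a :: l, b :: m, by simp [lcp, h]⟩

variable {α : Type*} [DecidableEq α]

/-- The Gromov product of two elements of a free group, for the word metric: the length of the
longest common prefix of their reduced words. -/
def gromov (a b : FreeGroup α) : ℕ := lcp a.toWord b.toWord

theorem gromov_comm (a b : FreeGroup α) : gromov a b = gromov b a := by
  apply le_antisymm <;> rw [gromov, gromov, le_lcp]
  · obtain ⟨h1, h2, h3⟩ := le_lcp.1 (le_refl (lcp a.toWord b.toWord)); exact ⟨h1.symm, h3, h2⟩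
  · obtain ⟨h1, h2, h3⟩ := le_lcp.1 (le_refl (lcp b.toWord a.toWord)); exact ⟨h1.symm, h3, h2⟩

theorem min_gromov_le (a b c : FreeGroup α) : min (gromov a b) (gromov b c) ≤ gromov a c := by
  obtain ⟨h1, h2, -⟩ := le_lcp.1 (min_le_left (gromov a b) (gromov b c))
  obtain ⟨h4, -, h6⟩ := le_lcp.1 (min_le_right (gromov a b) (gromov b c))
  exact le_lcp.2 ⟨h1.trans h4, h2, h6⟩

theorem isReduced_invRev {L : List (α × Bool)} (h : IsReduced L) : IsReduced (invRev L) := by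
  rw [isReduced_iff_reduce_eq] at h ⊢
  rw [reduce_invRev, h]

omit [DecidableEq α] in
theorem head?_invRev_eq {L : List (α × Bool)} {c : α × Bool} (h : c ∈ (invRev L).getLast?) :
    (c.1, !c.2) ∈ L.head? := by
  cases L with
  | nil => simp at h
  | cons a L =>
    simp [invRev] at h
    simp [← h]

theorem norm_inv_mul (a b : FreeGroup α) :
    norm (a⁻¹ * b) + 2 * gromov a b = norm a + norm b := by
  obtain ⟨p, A, B, hA, hB, hp, hAB⟩ := exists_eq_append_lcp a.toWord b.toWord
  have ha : a = mk p * mk A := by rw [mul_mk, ← hA, mk_toWord]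
  have hb : b = mk p * mk B := by rw [mul_mk, ← hB, mk_toWord]
  have h1 : a⁻¹ * b = mk (invRev A ++ B) := by rw [ha, hb, ← mul_mk, ← inv_mk]; group
  have rA : IsReduced A := (hA ▸ isReduced_toWord (x := a)).infix (List.suffix_append p A).isInfix
  have rB : IsReduced B := (hB ▸ isReduced_toWord (x := b)).infix (List.suffix_append p B).isInfix
  have h2 : IsReduced (invRev A ++ B) := by
    refine List.IsChain.append (isReduced_invRev rA) rB fun c hc d hd hcd => ?_
    have := hAB _ (head?_invRev_eq hc) _ hd
    by_contra hne
    apply this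
    ext1
    · exact hcd
    · revert hne; cases c.2 <;> cases d.2 <;> simp
  have h3 : norm (a⁻¹ * b) = A.length + B.length := by
    rw [h1, norm, toWord_mk, h2.reduce_eq, List.length_append, invRev_length]
  have h4 : norm a = p.length + A.length := by rw [norm, hA, List.length_append]
  have h5 : norm b = p.length + B.length := by rw [norm, hB, List.length_append]
  rw [gromov, ← hp]
  omega

theorem two_mul_gromov_inv_lt {a : FreeGroup α} (ha : a ≠ 1) : 2 * gromov a a⁻¹ < norm a := by
  by_contra! h
  have h0 : 0 < norm a := Nat.pos_of_ne_zero fun h => ha (norm_eq_zero.1 h)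
  obtain ⟨h1, h2, -⟩ := le_lcp.1 (le_refl (gromov a a⁻¹))
  rw [toWord_inv] at h1
  have red := isReduced_toWord (x := a)
  rw [norm] at h h0
  generalize a.toWord = L at *
  generalize gromov a a⁻¹ = c at *
  have key : ∀ k (hk : k < c), L[k]'(by omega) =
      ((L[L.length - 1 - k]'(by omega)).1, !(L[L.length - 1 - k]'(by omega)).2) := by
    intro k hk
    have := congrArg (fun l => l[k]?) h1
    simp only [List.getElem?_take, hk, if_true] at this
    rw [List.getElem?_eq_getElem (by omega), List.getElem?_eq_getElem (by simp; omega)] at this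
    simpa [invRev] using this
  rcases Nat.even_or_odd' L.length with ⟨k, hk | hk⟩
  · have h3 := key (k - 1) (by omega)
    have h4 := List.isChain_iff_getElem.1 red (k - 1) (by omega)
    have h5 : L.length - 1 - (k - 1) = k - 1 + 1 := by omega
    simp only [h5] at h3
    rw [h3] at h4
    simp at h4
  · have h3 := key k (by omega)
    have h5 : L.length - 1 - k = k := by omega
    simp only [h5] at h3
    have := congrArg Prod.snd h3
    simp at this

/-- If `u` is cancelled exactly by halves in `v * u⁻¹ * v`, then a conjugation makes the pair
`(u, v⁻¹ * u)` shorter than `(u, v)`. -/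
theorem exists_conj_norm_lt {u v : FreeGroup α} (hu : u ≠ 1) (h1 : norm u = 2 * gromov u v)
    (h2 : norm u = 2 * gromov u⁻¹ v⁻¹) (huv : norm u ≤ norm v) :
    ∃ g : FreeGroup α,
      norm (g * u * g⁻¹) + norm (g * (v⁻¹ * u) * g⁻¹) < norm u + norm v := by
  have h0 : 0 < norm u := Nat.pos_of_ne_zero fun h => hu (norm_eq_zero.1 h)
  obtain ⟨a1, a2, -⟩ := le_lcp.1 (le_refl (gromov u v))
  obtain ⟨b1, b2, -⟩ := le_lcp.1 (le_refl (gromov u⁻¹ v⁻¹))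
  have hk : gromov u⁻¹ v⁻¹ = gromov u v := by omega
  rw [hk] at b1
  set k := gromov u v
  set p := u.toWord.take k
  set q := u.toWord.drop k
  have hpq : u.toWord = p ++ q := (List.take_append_drop _ _).symm
  have hul : u.toWord.length = 2 * k := h1
  have hpl : p.length = k := by simp [p]; omega
  have hql : q.length = k := by simp [q]; omega
  have hvp : v.toWord = p ++ v.toWord.drop k := by rw [a1]; exact (List.take_append_drop _ _).symm
  have hvl : 2 * k ≤ v.toWord.length := by rw [← hul]; exact huv
  have hvq : ∃ l, v.toWord = l ++ q := by
    have : invRev q = (invRev v.toWord).take k := by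
      rw [← toWord_inv, ← b1, toWord_inv, hpq, invRev_append, List.take_left']
      simp [hql]
    refine ⟨invRev ((invRev v.toWord).drop k), ?_⟩
    rw [← invRev_invRev (L₁ := q), ← invRev_append, this, List.take_append_drop, invRev_invRev]
  obtain ⟨l, hl⟩ := hvq
  have ht : ∃ t, v.toWord = p ++ t ++ q := by
    have h3 := hvp.symm.trans hl
    have h4 : v.toWord.length = l.length + q.length := by rw [← List.length_append, ← hl]
    rcases List.append_eq_append_iff.1 h3 with ⟨t, h5, h6⟩ | ⟨t, h5, h6⟩
    · exact ⟨t, by rw [hl, h5]⟩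
    · have h7 : p.length = l.length + t.length := by rw [h5, List.length_append]
      have h8 : t = [] := List.length_eq_zero_iff.1 (by omega)
      refine ⟨[], ?_⟩
      rw [hl, h5, h8]; simp
  obtain ⟨t, ht⟩ := ht
  have hu' : u = mk p * mk q := by rw [mul_mk, ← hpq, mk_toWord]
  have hv' : v = mk p * mk t * mk q := by rw [mul_mk, mul_mk, ← ht, mk_toWord]
  have hvn : norm v = k + t.length + k := by
    rw [norm, ht, List.length_append, List.length_append, hpl, hql]
  refine ⟨mk q, ?_⟩
  have e1 : mk q * u * (mk q)⁻¹ = mk (q ++ p) := by rw [hu', ← mul_mk]; group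
  have e2 : mk q * (v⁻¹ * u) * (mk q)⁻¹ = (mk t)⁻¹ := by rw [hu', hv']; group
  rw [e1, e2, norm_inv_eq]
  have n1 : norm (mk (q ++ p)) ≤ (q ++ p).length := norm_mk_le
  have n2 : norm (mk t) ≤ t.length := norm_mk_le
  rw [List.length_append] at n1
  omega

/-- The formal inverse of a letter. -/
def flipLetter (s : α × Bool) : α × Bool := (s.1, !s.2)

omit [DecidableEq α] in
theorem mk_flipLetter (s : α × Bool) : mk [flipLetter s] = (mk [s])⁻¹ := by
  simp [flipLetter, inv_mk, invRev]

/-- The images of the letters under an automorphism form a Nielsen reduced set. -/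
structure NielsenReduced (φ : FreeGroup α ≃* FreeGroup α) : Prop where
  two_mul_gromov_le : ∀ s a, a ≠ s → 2 * gromov (φ (mk [s])) (φ (mk [a])) ≤ norm (φ (mk [s]))
  gromov_add_lt : ∀ s a b, a ≠ s → b ≠ flipLetter s →
    gromov (φ (mk [s])) (φ (mk [a])) + gromov (φ (mk [s]))⁻¹ (φ (mk [b])) < norm (φ (mk [s]))

omit [DecidableEq α] in
theorem map_mk_cons (φ : FreeGroup α ≃* FreeGroup α) (s : α × Bool) (L : List (α × Bool)) :
    φ (mk (s :: L)) = φ (mk [s]) * φ (mk L) := by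
  rw [← _root_.map_mul, mul_mk]; rfl

theorem gromov_map_mk_cons {φ : FreeGroup α ≃* FreeGroup α} (h : NielsenReduced φ)
    (s : α × Bool) (L : List (α × Bool)) (hL : IsReduced (s :: L)) (a : α × Bool) (ha : a ≠ s) :
    gromov (φ (mk [a])) (φ (mk (s :: L))) = gromov (φ (mk [a])) (φ (mk [s])) := by
  induction L generalizing s a with
  | nil => rfl
  | cons r L ih =>
    obtain ⟨h1, h2⟩ := isReduced_cons_cons.1 hL
    have hne : flipLetter s ≠ r := by
      rintro rfl
      simp [flipLetter] at h1
    have e1 := ih r h2 (flipLetter s) hne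
    rw [mk_flipLetter, _root_.map_inv] at e1
    have e2 := h.gromov_add_lt s a r ha hne.symm
    have n1 := norm_inv_mul (φ (mk [s]))⁻¹ (φ (mk (r :: L)))
    have n2 := norm_inv_mul (φ (mk [s])) (φ (mk (s :: r :: L)))
    rw [map_mk_cons φ s (r :: L), inv_mul_cancel_left, ← map_mk_cons φ s] at n2
    rw [inv_inv, ← map_mk_cons φ s, norm_inv_eq] at n1
    have m1 := min_gromov_le (φ (mk [a])) (φ (mk [s])) (φ (mk (s :: r :: L)))
    have m2 := min_gromov_le (φ (mk [a])) (φ (mk (s :: r :: L))) (φ (mk [s]))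
    rw [gromov_comm (φ (mk (s :: r :: L)))] at m2
    rw [gromov_comm (φ (mk [s])) (φ (mk [a]))] at e2
    omega

theorem norm_map_le_of_nielsenReduced {φ : FreeGroup α ≃* FreeGroup α} (h : NielsenReduced φ)
    (L : List (α × Bool)) (hL : IsReduced L) :
    ∀ s ∈ L, norm (φ (mk [s])) ≤ norm (φ (mk L)) := by
  induction L with
  | nil => simp
  | cons s L ih =>
    have n1 := norm_inv_mul (φ (mk [s]))⁻¹ (φ (mk L))
    rw [inv_inv, ← map_mk_cons φ s, norm_inv_eq] at n1
    cases L with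
    | nil => simp
    | cons r L =>
      obtain ⟨h1, h2⟩ := isReduced_cons_cons.1 hL
      have hne : flipLetter s ≠ r := by
        rintro rfl
        simp [flipLetter] at h1
      have e1 := gromov_map_mk_cons h r L h2 (flipLetter s) hne
      have e2 := h.two_mul_gromov_le (flipLetter s) r hne.symm
      have e3 := h.two_mul_gromov_le r (flipLetter s) hne
      rw [gromov_comm] at e3
      rw [mk_flipLetter, _root_.map_inv] at e1 e2 e3
      rw [norm_inv_eq] at e2
      have i1 := ih h2
      have i2 := i1 r (by simp)
      intro a ha
      rcases List.mem_cons.1 ha with rfl | ha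
      · omega
      · have := i1 a ha
        omega

theorem aut_ext {φ ψ : MulAut F2} (h0 : φ (of 0) = ψ (of 0)) (h1 : φ (of 1) = ψ (of 1)) :
    φ = ψ := by
  have : φ.toMonoidHom = ψ.toMonoidHom := by
    ext i
    fin_cases i
    · exact h0
    · exact h1
  exact MulEquiv.ext fun w => DFunLike.congr_fun this w

/-- The automorphism `x ↦ y`, `y ↦ x⁻¹`. -/
def sAut : MulAut F2 :=
  MonoidHom.toMulEquiv (FreeGroup.lift ![of 1, (of 0)⁻¹]) (FreeGroup.lift ![(of 1)⁻¹, of 0])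
    (by ext i; fin_cases i <;> simp) (by ext i; fin_cases i <;> simp)

/-- The automorphism `x ↦ y`, `y ↦ y⁻¹x⁻¹`. -/
def rAut : MulAut F2 :=
  MonoidHom.toMulEquiv (FreeGroup.lift ![of 1, (of 1)⁻¹ * (of 0)⁻¹])
    (FreeGroup.lift ![(of 1)⁻¹ * (of 0)⁻¹, of 0])
    (by ext i; fin_cases i <;> simp) (by ext i; fin_cases i <;> simp)

@[simp] theorem sAut_zero : sAut (of 0) = of 1 := by
  simp [sAut]
@[simp] theorem sAut_one : sAut (of 1) = (of 0)⁻¹ := by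
  simp [sAut]
@[simp] theorem rAut_zero : rAut (of 0) = of 1 := by
  simp [rAut]
@[simp] theorem rAut_one : rAut (of 1) = (of 1)⁻¹ * (of 0)⁻¹ := by
  simp [rAut]

/-- The subgroup of inner automorphisms. -/
def innerAut : Subgroup (MulAut F2) := (MulAut.conj : F2 →* MulAut F2).range

instance : innerAut.Normal where
  conj_mem := by
    rintro _ ⟨g, rfl⟩ φ
    exact ⟨φ g, MulEquiv.ext fun w => by simp [MulAut.mul_apply]⟩

/-- The subgroup of `Aut(F₂)` generated by the inner automorphisms, `sAut` and `rAut`. -/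
def elementary : Subgroup (MulAut F2) := Subgroup.closure {sAut, rAut} ⊔ innerAut

theorem sAut_mem : sAut ∈ elementary :=
  Subgroup.mem_sup_left (Subgroup.subset_closure (by simp))

theorem rAut_mem : rAut ∈ elementary :=
  Subgroup.mem_sup_left (Subgroup.subset_closure (by simp))

theorem conj_mem (g : F2) : MulAut.conj g ∈ elementary :=
  Subgroup.mem_sup_right ⟨g, rfl⟩

/-- The transvection `x ↦ x`, `y ↦ xy`. -/
def tAut : MulAut F2 := rAut * rAut * sAut

@[simp] theorem tAut_zero : tAut (of 0) = of 0 := by simp [tAut, MulAut.mul_apply]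
@[simp] theorem tAut_one : tAut (of 1) = of 0 * of 1 := by simp [tAut, MulAut.mul_apply]

theorem tAut_mem : tAut ∈ elementary := mul_mem (mul_mem rAut_mem rAut_mem) sAut_mem

theorem tAut_inv_zero : tAut⁻¹ (of 0) = of 0 := by
  rw [MulAut.inv_apply, MulEquiv.symm_apply_eq, tAut_zero]
theorem tAut_inv_one : tAut⁻¹ (of 1) = (of 0)⁻¹ * of 1 := by
  rw [MulAut.inv_apply, MulEquiv.symm_apply_eq, _root_.map_mul, _root_.map_inv, tAut_zero, tAut_one]
  simp

theorem mk_true (i : Fin 2) : (mk [(i, true)] : F2) = of i := rfl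
theorem mk_false (i : Fin 2) : (mk [(i, false)] : F2) = (of i)⁻¹ := rfl

theorem exists_transvection_one (e d : Bool) :
    ∃ ν ∈ elementary, ν (mk [(1, e)]) = mk [(1, e)] * mk [(0, d)] ∧
      ν (mk [(0, d)]) = mk [(0, d)] := by
  cases e <;> cases d
  · exact ⟨tAut, tAut_mem, by simp [mk_false], by simp [mk_false]⟩
  · exact ⟨tAut⁻¹, inv_mem tAut_mem,
      by simp only [mk_false, mk_true, _root_.map_inv, tAut_inv_one]; simp,
      by simp only [mk_true, tAut_inv_zero]⟩
  · refine ⟨MulAut.conj (of 0) * tAut⁻¹, mul_mem (conj_mem _) (inv_mem tAut_mem), ?_, ?_⟩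
    · rw [MulAut.mul_apply, mk_true, mk_false, tAut_inv_one, MulAut.conj_apply]; group
    · rw [MulAut.mul_apply, mk_false, _root_.map_inv, tAut_inv_zero, MulAut.conj_apply]; group
  · refine ⟨MulAut.conj (of 0)⁻¹ * tAut, mul_mem (conj_mem _) tAut_mem, ?_, ?_⟩
    · rw [MulAut.mul_apply, mk_true, mk_true, tAut_one, MulAut.conj_apply]; group
    · rw [MulAut.mul_apply, mk_true, tAut_zero, MulAut.conj_apply]; group

theorem exists_transvection (s a : Fin 2 × Bool) (h : a.1 ≠ s.1) :
    ∃ ν ∈ elementary, ν (mk [s]) = mk [s] * mk [a] ∧ ν (mk [a]) = mk [a] := by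
  obtain ⟨i, e⟩ := s
  obtain ⟨j, d⟩ := a
  by_cases hi : i = 1
  · obtain rfl : j = 0 := by dsimp at h; omega
    subst hi
    exact exists_transvection_one e d
  · obtain rfl : i = 0 := by omega
    obtain rfl : j = 1 := by dsimp at h; omega
    obtain ⟨ν, hν, h1, h2⟩ := exists_transvection_one (!e) d
    have e1 : sAut (mk [(1, !e)]) = mk [(0, e)] := by
      cases e <;> simp [mk_true, mk_false]
    have e2 : sAut (mk [(0, d)]) = mk [(1, d)] := by
      cases d <;> simp [mk_true, mk_false]
    refine ⟨sAut * ν * sAut⁻¹, mul_mem (mul_mem sAut_mem hν) (inv_mem sAut_mem), ?_, ?_⟩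
    · rw [← e1, ← e2, MulAut.mul_apply, MulAut.mul_apply, MulAut.inv_apply_self, h1,
        _root_.map_mul]
    · rw [← e2, MulAut.mul_apply, MulAut.mul_apply, MulAut.inv_apply_self, h2]

theorem norm_map_mk (φ : MulAut F2) (s : Fin 2 × Bool) :
    norm (φ (mk [s])) = norm (φ (of s.1)) := by
  obtain ⟨i, e⟩ := s
  cases e
  · rw [mk_false, _root_.map_inv, norm_inv_eq]
  · rfl

theorem norm_add_norm_eq (φ : MulAut F2) {s a : Fin 2 × Bool} (h : a.1 ≠ s.1) :
    norm (φ (of 0)) + norm (φ (of 1)) = norm (φ (mk [s])) + norm (φ (mk [a])) := by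
  rw [norm_map_mk, norm_map_mk]
  obtain ⟨i, e⟩ := s
  obtain ⟨j, d⟩ := a
  dsimp at h ⊢
  by_cases hi : i = 0
  · obtain rfl : j = 1 := by omega
    rw [hi]
  · obtain rfl : i = 1 := by omega
    obtain rfl : j = 0 := by omega
    rw [add_comm]

theorem eq_flipLetter {s a : Fin 2 × Bool} (h1 : a.1 = s.1) (h2 : a ≠ s) : a = flipLetter s := by
  obtain ⟨i, e⟩ := s
  obtain ⟨j, d⟩ := a
  dsimp at h1
  subst h1
  cases e <;> cases d <;> simp_all [flipLetter]

theorem flipLetter_flipLetter (s : Fin 2 × Bool) : flipLetter (flipLetter s) = s := by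
  simp [flipLetter]

theorem map_mk_ne_one (φ : MulAut F2) (s : Fin 2 × Bool) : φ (mk [s]) ≠ 1 := by
  rw [Ne, EmbeddingLike.map_eq_one_iff]
  obtain ⟨i, e⟩ := s
  cases e
  · rw [mk_false, inv_eq_one]; exact of_ne_one i
  · exact of_ne_one i

theorem nielsenReduced_of_minimal (ψ : MulAut F2)
    (hmin : ∀ ν ∈ elementary, norm (ψ (of 0)) + norm (ψ (of 1)) ≤
      norm ((ψ * ν) (of 0)) + norm ((ψ * ν) (of 1))) : NielsenReduced ψ := by
  have A : ∀ s a : Fin 2 × Bool, a.1 ≠ s.1 →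
      norm (ψ (mk [s])) ≤ norm (ψ (mk [s]) * ψ (mk [a])) := by
    intro s a h
    obtain ⟨ν, hν, h1, h2⟩ := exists_transvection s a h
    have := hmin ν hν
    rw [norm_add_norm_eq _ h, norm_add_norm_eq _ h, MulAut.mul_apply, MulAut.mul_apply, h1, h2,
      _root_.map_mul] at this
    omega
  have B : ∀ s a : Fin 2 × Bool, a.1 ≠ s.1 →
      2 * gromov (ψ (mk [s])) (ψ (mk [a])) ≤ norm (ψ (mk [s])) ∧
      2 * gromov (ψ (mk [s])) (ψ (mk [a])) ≤ norm (ψ (mk [a])) := by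
    intro s a h
    have h1 := A (flipLetter s) a h
    have h2 := A (flipLetter a) s h.symm
    have n1 := norm_inv_mul (ψ (mk [s])) (ψ (mk [a]))
    have n2 := norm_inv_mul (ψ (mk [a])) (ψ (mk [s]))
    rw [gromov_comm] at n2
    rw [mk_flipLetter, _root_.map_inv, norm_inv_eq] at h1 h2
    omega
  have C : ∀ s : Fin 2 × Bool,
      2 * gromov (ψ (mk [s])) (ψ (mk [s]))⁻¹ < norm (ψ (mk [s])) := fun s =>
    two_mul_gromov_inv_lt (map_mk_ne_one ψ s)
  have D : ∀ s a : Fin 2 × Bool, a.1 ≠ s.1 →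
      ¬ (norm (ψ (mk [s])) = 2 * gromov (ψ (mk [s])) (ψ (mk [a])) ∧
        norm (ψ (mk [s])) = 2 * gromov (ψ (mk [s]))⁻¹ (ψ (mk [a]))⁻¹) := by
    rintro s a h ⟨h1, h2⟩
    obtain ⟨g, hg⟩ := exists_conj_norm_lt (map_mk_ne_one ψ s) h1 h2 (h1.trans_le (B s a h).2)
    obtain ⟨ν, hν, h3, h4⟩ := exists_transvection (flipLetter a) s h.symm
    have := hmin _ (mul_mem (conj_mem (ψ.symm g)) hν)
    rw [norm_add_norm_eq _ h, norm_add_norm_eq (s := flipLetter a) _ h.symm] at this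
    simp only [MulAut.mul_apply, h3, h4] at this
    simp only [MulAut.conj_apply, _root_.map_mul, _root_.map_inv,
      MulEquiv.apply_symm_apply, mk_flipLetter] at this
    have e : (g * ψ (mk [a]) * g⁻¹)⁻¹ * (g * ψ (mk [s]) * g⁻¹) =
        g * ((ψ (mk [a]))⁻¹ * ψ (mk [s])) * g⁻¹ := by group
    rw [e] at this
    omega
  have E : ∀ s a : Fin 2 × Bool, a ≠ s →
      2 * gromov (ψ (mk [s])) (ψ (mk [a])) ≤ norm (ψ (mk [s])) := by
    intro s a h
    by_cases h1 : a.1 = s.1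
    · rw [eq_flipLetter h1 h, mk_flipLetter, _root_.map_inv]
      exact (C s).le
    · exact (B s a h1).1
  refine ⟨E, fun s a b ha hb => ?_⟩
  have Ea := E s a ha
  have Eb := E (flipLetter s) b hb
  rw [mk_flipLetter, _root_.map_inv, norm_inv_eq] at Eb
  have Cs := C s
  by_cases h1 : a.1 = s.1
  · rw [eq_flipLetter h1 ha, mk_flipLetter, _root_.map_inv] at Ea ⊢
    omega
  by_cases h2 : b.1 = s.1
  · rw [eq_flipLetter (s := flipLetter s) h2 hb, flipLetter_flipLetter, 
      gromov_comm (ψ (mk [s]))⁻¹] at Eb ⊢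
    omega
  by_cases hab : b = a
  · subst hab
    have := min_gromov_le (ψ (mk [s])) (ψ (mk [b])) (ψ (mk [s]))⁻¹
    rw [gromov_comm (ψ (mk [b]))] at this
    omega
  · have hab1 : b.1 = a.1 := by omega
    have := D s a h1
    rw [eq_flipLetter hab1 hab, mk_flipLetter, _root_.map_inv] at Eb ⊢
    omega

theorem exists_nielsenReduced (φ : MulAut F2) :
    ∃ ν ∈ elementary, NielsenReduced (φ * ν) := by
  obtain ⟨ν, hν, h⟩ := Nat.sInf_mem (s := {n | ∃ ν ∈ elementary,
    norm ((φ * ν) (of 0)) + norm ((φ * ν) (of 1)) = n}) ⟨_, 1, one_mem _, rfl⟩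
  refine ⟨ν, hν, nielsenReduced_of_minimal _ fun μ hμ => ?_⟩
  rw [mul_assoc, h]
  exact Nat.sInf_le ⟨ν * μ, mul_mem hν hμ, rfl⟩

theorem expSum_mk_eq_one {i : Fin 2} (L : List (Fin 2 × Bool)) (h : ∀ s ∈ L, s.1 ≠ i) :
    expSum i (mk L) = 1 := by
  induction L with
  | nil => exact _root_.map_one _
  | cons s L ih =>
    have e : (mk (s :: L) : F2) = mk [s] * mk L := rfl
    rw [e, _root_.map_mul, ih fun r hr => h r (List.mem_cons_of_mem _ hr), mul_one]
    have h1 := h s List.mem_cons_self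
    obtain ⟨j, b⟩ := s
    cases b <;> simp_all [expSum]

theorem norm_eq_one_of_nielsenReduced {φ : MulAut F2} (h : NielsenReduced φ) (i : Fin 2) :
    norm (φ (of i)) = 1 := by
  by_contra hne
  have h0 : norm (φ (of i)) ≠ 0 := by
    rw [Ne, norm_eq_zero]; exact map_mk_ne_one φ (i, true)
  have key : ∀ j, expSum i (φ.symm (of j)) = 1 := by
    intro j
    rw [← mk_toWord (x := φ.symm (of j))]
    refine expSum_mk_eq_one _ fun s hs hi => ?_
    have h1 := norm_map_le_of_nielsenReduced h _ isReduced_toWord s hs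
    rw [mk_toWord, MulEquiv.apply_symm_apply, norm_of, norm_map_mk, hi] at h1
    omega
  have h2 : (expSum i).comp φ.symm.toMonoidHom = 1 := by
    ext j; simp [key]
  have h3 := DFunLike.congr_fun h2 (φ (of i))
  simp [expSum] at h3

theorem toAdd_expSum_map (φ : MulAut F2) (i : Fin 2) (w : F2) :
    Multiplicative.toAdd (expSum i (φ w)) =
      ∑ k, autMat φ i k * Multiplicative.toAdd (expSum k w) := by
  induction w using FreeGroup.induction_on with
  | C1 => simp
  | of j => simp [autMat, expSum]
  | inv_of j h => simp only [_root_.map_inv, toAdd_inv, h, mul_neg, Finset.sum_neg_distrib]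
  | mul a b ha hb =>
    simp only [_root_.map_mul, toAdd_mul, ha, hb, mul_add, Finset.sum_add_distrib]

theorem autMat_mul (φ ψ : MulAut F2) : autMat (φ * ψ) = autMat φ * autMat ψ := by
  ext i j
  rw [Matrix.mul_apply]
  exact toAdd_expSum_map φ i (ψ (of j))

theorem autMat_one : autMat (1 : MulAut F2) = 1 := by
  ext i j
  fin_cases i <;> fin_cases j <;> simp [autMat, expSum]

/-- `autMat` as a monoid homomorphism. -/
def autMatHom : MulAut F2 →* Matrix (Fin 2) (Fin 2) ℤ where
  toFun := autMat
  map_one' := autMat_one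
  map_mul' := autMat_mul

theorem autMatHom_apply (φ : MulAut F2) : autMatHom φ = autMat φ := rfl

theorem autMatHom_of_mem_inner {φ : MulAut F2} (h : φ ∈ innerAut) : autMatHom φ = 1 := by
  obtain ⟨g, rfl⟩ := h
  rw [← _root_.map_one autMatHom]
  ext i j
  simp [autMatHom_apply, autMat]

theorem autMatHom_sAut : autMatHom sAut = !![0, -1; 1, 0] := by
  ext i j
  fin_cases i <;> fin_cases j <;> simp [autMatHom_apply, autMat, expSum]

theorem autMatHom_rAut : autMatHom rAut = !![0, -1; 1, -1] := by
  ext i j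
  fin_cases i <;> fin_cases j <;> simp [autMatHom_apply, autMat, expSum]

theorem det_of_mem_elementary {φ : MulAut F2} (h : φ ∈ elementary) :
    (autMatHom φ).det = 1 := by
  let d : MulAut F2 →* ℤ := (Matrix.detMonoidHom).comp autMatHom
  have hle : elementary ≤ d.ker := by
    refine sup_le ((Subgroup.closure_le _).2 ?_) fun ψ hψ => ?_
    · rintro ψ (rfl | rfl)
      · simp [d, MonoidHom.mem_ker, autMatHom_sAut, Matrix.det_fin_two]
      · simp [d, MonoidHom.mem_ker, autMatHom_rAut, Matrix.det_fin_two]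
    · simp [d, MonoidHom.mem_ker, autMatHom_of_mem_inner hψ]
  exact hle h

theorem exists_eq_mk_of_norm_eq_one {w : F2} (h : norm w = 1) : ∃ s, w = mk [s] := by
  obtain ⟨s, hs⟩ := List.length_eq_one_iff.1 h
  exact ⟨s, by rw [← hs, mk_toWord]⟩

/-- The automorphisms of `F₂` of determinant one are generated by the inner ones, `sAut` and
`rAut`. -/
theorem mem_elementary {φ : MulAut F2} (h : (autMatHom φ).det = 1) : φ ∈ elementary := by
  obtain ⟨ν, hν, hred⟩ := exists_nielsenReduced φ
  suffices φ * ν ∈ elementary from (Subgroup.mul_mem_cancel_right _ hν).1 this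
  have hdet : (autMatHom (φ * ν)).det = 1 := by
    rw [_root_.map_mul, Matrix.det_mul, h, det_of_mem_elementary hν, one_mul]
  generalize φ * ν = ψ at hred hdet
  obtain ⟨s, hs⟩ := exists_eq_mk_of_norm_eq_one (norm_eq_one_of_nielsenReduced hred 0)
  obtain ⟨a, ha⟩ := exists_eq_mk_of_norm_eq_one (norm_eq_one_of_nielsenReduced hred 1)
  have two := mul_mem sAut_mem sAut_mem
  rw [Matrix.det_fin_two] at hdet
  simp only [autMatHom_apply, autMat, Matrix.of_apply, hs, ha] at hdet
  fin_cases s <;> fin_cases a <;>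
    first
    | (exfalso; simp [expSum] at hdet; done)
    | (rw [show ψ = 1 from aut_ext hs ha]; exact one_mem _)
    | (rw [show ψ = sAut from aut_ext (by rw [hs, sAut_zero]; rfl) (by rw [ha, sAut_one]; rfl)]
       exact sAut_mem)
    | (rw [show ψ = sAut * sAut from aut_ext (by rw [hs]; simp [MulAut.mul_apply]; rfl)
         (by rw [ha]; simp [MulAut.mul_apply]; rfl)]
       exact two)
    | (rw [show ψ = sAut * sAut * sAut from aut_ext (by rw [hs]; simp [MulAut.mul_apply]; rfl)
         (by rw [ha]; simp [MulAut.mul_apply]; rfl)]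
       exact mul_mem two sAut_mem)

section NormalForm

variable {Q : Type*} [Group Q]

/-- A lift to words in `R` and `S` of one of the two elementary matrices `!![1, 0; 1, 1]` and
`!![1, 1; 0, 1]`. -/
def letter (R S : Q) (b : Bool) : Q := if b then S ^ 2 * R * S else R ^ 2 * S

/-- Normal form in a group generated by `R` and `S` with `R ^ 3 = 1`, `S ^ 4 = 1` and `S ^ 2`
central. -/
theorem exists_normalForm {R S : Q} (hR : R ^ 3 = 1) (hS : S ^ 4 = 1)
    (hc : R * S ^ 2 = S ^ 2 * R) {q : Q} (hq : q ∈ Subgroup.closure {R, S}) :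
    ∃ (i b a : ℕ) (m : List Bool), b < 2 ∧ a < 3 ∧
      q = (S ^ 2) ^ i * S ^ b * (m.map (letter R S)).prod * R ^ a := by
  have hci : ∀ i w, R * ((S ^ 2) ^ i * w) = (S ^ 2) ^ i * (R * w) := fun i w => by
    rw [← mul_assoc, ← mul_assoc, ((show Commute R (S ^ 2) from hc).pow_right i).eq]
  have hZ : S ^ 2 * S ^ 2 = 1 := by rw [← pow_add, hS]
  have stepS : ∀ q : Q, (∃ (i b a : ℕ) (m : List Bool), b < 2 ∧ a < 3 ∧
      q = (S ^ 2) ^ i * S ^ b * (m.map (letter R S)).prod * R ^ a) →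
      ∃ (i b a : ℕ) (m : List Bool), b < 2 ∧ a < 3 ∧
      S * q = (S ^ 2) ^ i * S ^ b * (m.map (letter R S)).prod * R ^ a := by
    rintro _ ⟨i, b, a, m, hb, ha, rfl⟩
    interval_cases b
    · exact ⟨i, 1, a, m, by omega, ha, by simp only [← mul_assoc, ← pow_mul]; group⟩
    · exact ⟨i + 1, 0, a, m, by omega, ha, by simp only [← mul_assoc, ← pow_mul]; group⟩
  have stepR : ∀ q : Q, (∃ (i b a : ℕ) (m : List Bool), b < 2 ∧ a < 3 ∧
      q = (S ^ 2) ^ i * S ^ b * (m.map (letter R S)).prod * R ^ a) →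
      ∃ (i b a : ℕ) (m : List Bool), b < 2 ∧ a < 3 ∧
      R * q = (S ^ 2) ^ i * S ^ b * (m.map (letter R S)).prod * R ^ a := by
    rintro _ ⟨i, b, a, m, hb, ha, rfl⟩
    simp only [mul_assoc, hci]
    interval_cases b
    · cases m with
      | nil =>
        by_cases h2 : a = 2
        · exact ⟨i, 0, 0, [], by omega, by omega, by subst h2; simp [← pow_succ', hR]⟩
        · exact ⟨i, 0, a + 1, [], by omega, by omega, by simp [pow_succ']⟩
      | cons c m =>
        cases c
        · refine ⟨i, 1, a, m, by omega, ha, ?_⟩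
          have : ∀ w, R * (R ^ 2 * w) = w := fun w => by rw [← mul_assoc, ← pow_succ', hR, one_mul]
          simp [letter, mul_assoc, this]
        · refine ⟨i + 1, 0, a, false :: m, by omega, ha, ?_⟩
          have := hci 1
          simp only [pow_one] at this
          simp [letter, mul_assoc, pow_succ _ i, pow_two R, this]
    · refine ⟨i + 1, 0, a, true :: m, by omega, ha, ?_⟩
      have : ∀ w, S ^ 2 * (S ^ 2 * w) = w := fun w => by rw [← mul_assoc, hZ, one_mul]
      simp [pow_succ _ i, letter, mul_assoc, this]
  induction hq using Subgroup.closure_induction_left with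
  | one => exact ⟨0, 0, 0, [], by simp⟩
  | mul_left x hx y hy ih =>
    rcases hx with rfl | rfl
    · exact stepR _ ih
    · exact stepS _ ih
  | inv_mul_cancel x hx y hy ih =>
    rcases hx with rfl | rfl
    · rw [show x⁻¹ = x * x by rw [inv_eq_iff_mul_eq_one, ← hR, pow_succ', pow_two], mul_assoc]
      exact stepR _ (stepR _ ih)
    · rw [show x⁻¹ = x * (x * x) by
        rw [inv_eq_iff_mul_eq_one, ← hS, pow_succ', pow_succ', pow_two], mul_assoc, mul_assoc]
      exact stepS _ (stepS _ (stepS _ ih))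

/-- A homomorphism to integral matrices which sends `R` and `S` to the standard generators
of `SL₂(ℤ)` is injective as soon as `R` and `S` satisfy the standard relations. -/
theorem eq_one_of_map_eq_one {R S : Q} (hR : R ^ 3 = 1) (hS : S ^ 4 = 1)
    (hc : R * S ^ 2 = S ^ 2 * R) (f : Q →* Matrix (Fin 2) (Fin 2) ℤ)
    (fR : f R = !![0, -1; 1, -1]) (fS : f S = !![0, -1; 1, 0]) {q : Q}
    (hq : q ∈ Subgroup.closure {R, S}) (h : f q = 1) : q = 1 := by
  obtain ⟨i, b, a, m, hb, ha, rfl⟩ := exists_normalForm hR hS hc hq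
  have lt : f (letter R S true) = !![1, 0; 1, 1] := by simp [letter, fR, fS, pow_two]
  have lf : f (letter R S false) = !![1, 1; 0, 1] := by simp [letter, fR, fS, pow_two]
  have hnonneg : ∀ m : List Bool, ∀ j k, 0 ≤ f (m.map (letter R S)).prod j k := by
    intro m
    induction m with
    | nil => intro j k; fin_cases j <;> fin_cases k <;> simp
    | cons c m ih =>
      have := ih 0 0; have := ih 0 1; have := ih 1 0; have := ih 1 1
      intro j k
      rw [List.map_cons, List.prod_cons, _root_.map_mul, Matrix.mul_apply, Fin.sum_univ_two]
      cases c
      · rw [lf]; fin_cases j <;> fin_cases k <;> simp <;> omega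
      · rw [lt]; fin_cases j <;> fin_cases k <;> simp <;> omega
  have hZ : f ((S ^ 2) ^ i) = (-1) ^ i := by
    rw [_root_.map_pow]; congr 1; ext j k
    fin_cases j <;> fin_cases k <;> simp [fS, pow_two]
  have n00 := hnonneg m 0 0
  have n01 := hnonneg m 0 1
  have n10 := hnonneg m 1 0
  have n11 := hnonneg m 1 1
  simp only [_root_.map_mul, hZ, _root_.map_pow f S, _root_.map_pow f R, fR, fS] at h
  have hN := Matrix.eta_fin_two (f (m.map (letter R S)).prod)
  rw [hN] at h
  have key : b = 0 ∧ a = 0 ∧ Even i := by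
    rcases Nat.even_or_odd i with hi | hi
    · rw [hi.neg_one_pow] at h
      interval_cases b <;> interval_cases a <;>
        simp [pow_two, ← Matrix.ext_iff, Fin.forall_fin_two] at h ⊢ <;> first | exact hi | omega
    · rw [hi.neg_one_pow] at h
      interval_cases b <;> interval_cases a <;>
        simp [pow_two, ← Matrix.ext_iff, Fin.forall_fin_two] at h ⊢ <;> omega
  obtain ⟨rfl, rfl, hi⟩ := key
  rw [hi.neg_one_pow, ← hN] at h
  simp only [pow_zero, one_mul, mul_one] at h
  have hm : m = [] := by
    cases m with
    | nil => rfl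
    | cons c m =>
      exfalso
      have := hnonneg m 0 0; have := hnonneg m 0 1
      have := hnonneg m 1 0; have := hnonneg m 1 1
      rw [List.map_cons, List.prod_cons, _root_.map_mul,
        Matrix.eta_fin_two (f (m.map (letter R S)).prod)] at h
      cases c
      · simp [lf, ← Matrix.ext_iff, Fin.forall_fin_two] at h; omega
      · simp [lt, ← Matrix.ext_iff, Fin.forall_fin_two] at h; omega
  subst hm
  obtain ⟨k, rfl⟩ := hi
  rw [← two_mul, pow_mul, pow_two (S ^ 2), ← pow_add, hS]
  simp

end NormalForm

/-- An automorphism of `F₂` acting trivially on the abelianization is inner. -/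
theorem mem_innerAut {φ : MulAut F2} (h : autMatHom φ = 1) : φ ∈ innerAut := by
  have hel := mem_elementary (φ := φ) (by rw [h, Matrix.det_one])
  let p := QuotientGroup.mk' innerAut
  let f : MulAut F2 ⧸ innerAut →* Matrix (Fin 2) (Fin 2) ℤ :=
    QuotientGroup.lift innerAut autMatHom fun ψ hψ => autMatHom_of_mem_inner hψ
  have hp : p φ ∈ Subgroup.closure {p rAut, p sAut} := by
    have : elementary.map p = Subgroup.closure {p sAut, p rAut} := by
      rw [elementary, Subgroup.map_sup, MonoidHom.map_closure, Set.image_pair,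
        (Subgroup.map_eq_bot_iff _).2 (QuotientGroup.ker_mk' innerAut).ge, sup_bot_eq]
    rw [Set.pair_comm, ← this]
    exact Subgroup.mem_map_of_mem p hel
  have hker : ∀ ψ, p ψ = 1 ↔ ψ ∈ innerAut := QuotientGroup.eq_one_iff
  rw [← hker]
  refine eq_one_of_map_eq_one ?_ ?_ ?_ f autMatHom_rAut autMatHom_sAut hp h
  · rw [← _root_.map_pow, show rAut ^ 3 = 1 from ?_, _root_.map_one]
    refine aut_ext ?_ ?_ <;> simp [pow_succ, MulAut.mul_apply]
  · rw [← _root_.map_pow, show sAut ^ 4 = 1 from ?_, _root_.map_one]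
    refine aut_ext ?_ ?_ <;> simp [pow_succ, MulAut.mul_apply]
  · rw [← _root_.map_pow, ← _root_.map_mul, ← _root_.map_mul, ← mul_inv_eq_one,
      ← _root_.map_inv, ← _root_.map_mul, hker]
    refine ⟨(of 1)⁻¹, ?_⟩
    rw [eq_mul_inv_iff_mul_eq]
    refine aut_ext ?_ ?_ <;> simp [pow_succ, MulAut.mul_apply, mul_assoc]

/-- The transvection `x ↦ yx`, `y ↦ y`. -/
def lAut : MulAut F2 := sAut * sAut * rAut * sAut

@[simp] theorem lAut_zero : lAut (of 0) = of 1 * of 0 := by simp [lAut, MulAut.mul_apply]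
@[simp] theorem lAut_one : lAut (of 1) = of 1 := by simp [lAut, MulAut.mul_apply]

theorem lAut_inv_zero : lAut⁻¹ (of 0) = (of 1)⁻¹ * of 0 := by
  rw [MulAut.inv_apply, MulEquiv.symm_apply_eq, _root_.map_mul, _root_.map_inv, lAut_zero, lAut_one]
  simp
theorem lAut_inv_one : lAut⁻¹ (of 1) = of 1 := by
  rw [MulAut.inv_apply, MulEquiv.symm_apply_eq, lAut_one]

theorem tAut_zpow (c : ℤ) :
    (tAut ^ c) (of 0) = of 0 ∧ (tAut ^ c) (of 1) = of 0 ^ c * of 1 := by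
  induction c using Int.induction_on with
  | zero => simp
  | succ i ih =>
    rw [zpow_add_one, MulAut.mul_apply, MulAut.mul_apply, tAut_zero, tAut_one, _root_.map_mul,
      ih.1, ih.2]
    exact ⟨rfl, by group⟩
  | pred i ih =>
    rw [zpow_sub_one, MulAut.mul_apply, MulAut.mul_apply, tAut_inv_zero, tAut_inv_one,
      _root_.map_mul, _root_.map_inv, ih.1, ih.2]
    exact ⟨rfl, by group⟩

theorem lAut_zpow (d : ℤ) :
    (lAut ^ d) (of 0) = of 1 ^ d * of 0 ∧ (lAut ^ d) (of 1) = of 1 := by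
  induction d using Int.induction_on with
  | zero => simp
  | succ i ih =>
    rw [zpow_add_one, MulAut.mul_apply, MulAut.mul_apply, lAut_zero, lAut_one, _root_.map_mul,
      ih.1, ih.2]
    exact ⟨by group, rfl⟩
  | pred i ih =>
    rw [zpow_sub_one, MulAut.mul_apply, MulAut.mul_apply, lAut_inv_zero, lAut_inv_one,
      _root_.map_mul, _root_.map_inv, ih.1, ih.2]
    exact ⟨by group, rfl⟩

theorem autMatHom_tAut_zpow (c : ℤ) : autMatHom (tAut ^ c) = !![1, c; 0, 1] := by
  ext i j
  fin_cases i <;> fin_cases j <;> simp [autMatHom_apply, autMat, expSum, tAut_zpow]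

theorem autMatHom_lAut_zpow (d : ℤ) : autMatHom (lAut ^ d) = !![1, 0; d, 1] := by
  ext i j
  fin_cases i <;> fin_cases j <;> simp [autMatHom_apply, autMat, expSum, lAut_zpow]

/-- The commutator of the powers `tAut ^ c` and `lAut ^ d`. -/
def commAut (c d : ℤ) : MulAut F2 := tAut ^ c * lAut ^ d * tAut ^ (-c) * lAut ^ (-d)

theorem commAut_one (c d : ℤ) :
    commAut c d (of 1) = ((of 0 ^ c * of 1) ^ d * of 0) ^ (-c) * (of 0 ^ c * of 1) := by
  simp only [commAut, MulAut.mul_apply, lAut_zpow, tAut_zpow, _root_.map_mul, map_zpow]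

theorem autMatHom_commAut (c d : ℤ) : autMatHom (commAut c d) =
    !![1 + c * d + c ^ 2 * d ^ 2, -c ^ 2 * d; c * d ^ 2, 1 - c * d] := by
  simp only [commAut, _root_.map_mul, autMatHom_tAut_zpow, autMatHom_lAut_zpow]
  ext i j
  fin_cases i <;> fin_cases j <;> simp <;> ring

/-- The action of `x` on the cosets of `U_D`. -/
def permX : Equiv.Perm (Fin 5) := ⟨![2, 0, 1, 3, 4], ![1, 2, 0, 3, 4], by decide, by decide⟩

/-- The action of `y` on the cosets of `U_D`. -/
def permY : Equiv.Perm (Fin 5) := ⟨![4, 2, 1, 0, 3], ![3, 2, 1, 4, 0], by decide, by decide⟩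

/-- The action of `F₂` on the cosets of `U_D`. -/
def monodromy : F2 →* Equiv.Perm (Fin 5) := FreeGroup.lift ![permX, permY]

@[simp] theorem monodromy_zero : monodromy (of 0) = permX := by simp [monodromy]
@[simp] theorem monodromy_one : monodromy (of 1) = permY := by simp [monodromy]

/-- Representatives of the cosets of `U_D`. -/
def rep : Fin 5 → F2 := ![1, xg, xg ^ 2, yg, yg ^ 2]

theorem rep_mul_mem (g : F2) : ∀ i, rep i * g * (rep ((monodromy g)⁻¹ i))⁻¹ ∈ UD := by
  induction g using FreeGroup.induction_on with
  | C1 => intro i; simp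
  | of j =>
    have mem : ∀ w ∈ ({xg ^ 3, xg * yg * (xg ^ 2)⁻¹, xg ^ 2 * yg * xg⁻¹, yg * xg * yg⁻¹,
      yg ^ 2 * xg * (yg ^ 2)⁻¹, yg ^ 3} : Set F2), w ∈ UD := fun w hw => Subgroup.subset_closure hw
    simp only [Set.mem_insert_iff, Set.mem_singleton_iff, forall_eq_or_imp, forall_eq] at mem
    obtain ⟨m1, m2, m3, m4, m5, m6⟩ := mem
    intro i
    fin_cases j
    · change rep i * xg * (rep ((monodromy (of 0))⁻¹ i))⁻¹ ∈ UD
      rw [monodromy_zero, show permX⁻¹ i = ![1, 2, 0, 3, 4] i from rfl]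
      fin_cases i
      · simp [rep]
      · simp [rep, pow_two]
      · simpa [rep, pow_succ] using m1
      · exact m4
      · exact m5
    · change rep i * yg * (rep ((monodromy (of 1))⁻¹ i))⁻¹ ∈ UD
      rw [monodromy_one, show permY⁻¹ i = ![3, 2, 1, 4, 0] i from rfl]
      fin_cases i
      · simp [rep]
      · exact m2
      · exact m3
      · simp [rep, pow_two]
      · simpa [rep, pow_succ] using m6
  | inv_of j h =>
    intro i
    have := inv_mem (h (monodromy (of j) i))
    simpa [mul_assoc] using this
  | mul a b ha hb =>
    intro i
    have := mul_mem (ha i) (hb ((monodromy a)⁻¹ i))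
    simpa [mul_assoc] using this

theorem mem_UD_iff {g : F2} : g ∈ UD ↔ monodromy g 0 = 0 := by
  constructor
  · intro h
    have hle : UD ≤ (MulAction.stabilizer (Equiv.Perm (Fin 5)) (0 : Fin 5)).comap monodromy := by
      refine (Subgroup.closure_le _).2 ?_
      rintro w (rfl | rfl | rfl | rfl | rfl | rfl) <;>
        simp [xg, yg, MulAction.mem_stabilizer_iff] <;> decide
    exact hle h
  · intro h
    have := rep_mul_mem g 0
    rw [Equiv.Perm.inv_eq_iff_eq.2 h.symm] at this
    simpa [rep] using this

theorem monodromy_rep (i : Fin 5) : monodromy (rep i) i = 0 := by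
  fin_cases i <;> simp [rep, xg, yg] <;> decide

/-- The elements of `Stab(U_D)` preserve the kernel of the monodromy. -/
theorem monodromy_map_eq_one {γ : MulAut F2} (hγ : Subgroup.map γ.toMonoidHom UD = UD) {w : F2}
    (hw : monodromy w = 1) : monodromy (γ w) = 1 := by
  ext1 i
  have h1 : γ (γ.symm (rep i) * w * (γ.symm (rep i))⁻¹) ∈ UD := by
    rw [← hγ]
    refine Subgroup.mem_map_of_mem γ.toMonoidHom ?_
    simp [mem_UD_iff, hw]
  have h2 : (monodromy (rep i))⁻¹ 0 = i := by
    rw [Equiv.Perm.inv_eq_iff_eq, monodromy_rep]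
  rw [mem_UD_iff] at h1
  simp only [_root_.map_mul, _root_.map_inv, MulEquiv.apply_symm_apply, Equiv.Perm.mul_apply,
    h2] at h1
  rw [← Equiv.Perm.eq_inv_iff_eq, h2] at h1
  exact h1

theorem zpow_eq_one_of_dvd {G : Type*} [Group G] {g : G} {k : ℕ} {c : ℤ} (h : g ^ k = 1)
    (hc : (k : ℤ) ∣ c) : g ^ c = 1 := by
  obtain ⟨e, rfl⟩ := hc
  rw [zpow_mul, zpow_natCast, h, one_zpow]

theorem monodromy_commAut {c d : ℤ} (hcd : c + d = 1) (h3 : 3 ∣ d) (h4 : 4 ∣ c) :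
    monodromy (commAut c d (of 1)) = permX * permY := by
  have hx : permX ^ c = permX := by
    rw [show c = -d + 1 by omega, zpow_add_one,
      zpow_eq_one_of_dvd (k := 3) (by decide) (by simpa using h3), one_mul]
  have hd : (permX * permY) ^ d = permX * permY := by
    rw [show d = -c + 1 by omega, zpow_add_one,
      zpow_eq_one_of_dvd (k := 4) (by decide) (by simpa using h4), one_mul]
  rw [commAut_one]
  simp only [_root_.map_mul, map_zpow, monodromy_zero, monodromy_one, hx, hd]
  rw [zpow_eq_one_of_dvd (k := 4) (by decide) (by simpa using h4), one_mul]

theorem exists_exponents {n : ℕ} (hn : 1 ≤ n) :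
    ∃ c d : ℤ, c + d = 1 ∧ 3 ∣ d ∧ 4 ∣ c ∧ (n : ℤ) ∣ c * d := by
  obtain ⟨e, m, hm, rfl⟩ := Nat.exists_eq_two_pow_mul_odd (n := n) (by omega)
  have hco : IsCoprime ((2 : ℤ) ^ (e + 2)) (3 * m) := by
    refine IsCoprime.pow_left (IsCoprime.mul_right (by norm_num) ?_)
    exact_mod_cast Nat.isCoprime_iff_coprime.2 (Nat.coprime_two_left.2 hm)
  obtain ⟨u, v, h⟩ := hco
  refine ⟨u * 2 ^ (e + 2), v * (3 * m), h, ⟨v * m, by ring⟩, ⟨u * 2 ^ e, by ring⟩,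
    ⟨12 * u * v, by push_cast; ring⟩⟩

theorem not_mem_stabSet_UD {c d : ℤ} (hcd : c + d = 1) (h3 : 3 ∣ d) (h4 : 4 ∣ c) {γ : MulAut F2}
    (hγ : autMatHom γ = autMatHom (commAut c d)) : γ ∉ StabSet UD := by
  rintro ⟨-, h⟩
  have hin : (commAut c d)⁻¹ * γ ∈ innerAut := by
    refine mem_innerAut ?_
    rw [_root_.map_mul, hγ, ← _root_.map_mul, inv_mul_cancel, _root_.map_one]
  obtain ⟨g, hg⟩ := hin
  rw [eq_inv_mul_iff_mul_eq] at hg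
  have h1 := monodromy_map_eq_one h (w := of 1 ^ 6) (by
    rw [_root_.map_pow, monodromy_one]; decide)
  simp only [← hg, MulAut.mul_apply, MulAut.conj_apply, _root_.map_mul, _root_.map_inv,
    _root_.map_pow, conj_pow, conj_eq_one_iff, monodromy_commAut hcd h3 h4] at h1
  exact absurd h1 (by decide)

end FreeGroup

/-- The Veech group `Γ(U_D)` of the origami `D` is not a congruence subgroup of `SL₂(ℤ)`. -/
theorem veech_UD_not_congruence : ¬ IsCongruenceSet (VeechGroup UD) := by
  rintro ⟨n, hn, hsub⟩
  obtain ⟨c, d, hcd, h3, h4, hdvd⟩ := FreeGroup.exists_exponents hn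
  have hdet : (FreeGroup.autMatHom (FreeGroup.commAut c d)).det = 1 := by
    rw [FreeGroup.autMatHom_commAut, Matrix.det_fin_two_of]; ring
  have hmem : (⟨_, hdet⟩ : SL2Z) ∈ CongruenceSubgroup.Gamma n := by
    have hz : (c : ZMod n) * d = 0 := by
      rw [← Int.cast_mul, ZMod.intCast_zmod_eq_zero_iff_dvd]; exact hdvd
    refine CongruenceSubgroup.Gamma_mem.2 ?_
    change ((FreeGroup.autMatHom (FreeGroup.commAut c d) 0 0 : ℤ) : ZMod n) = 1 ∧
      ((FreeGroup.autMatHom (FreeGroup.commAut c d) 0 1 : ℤ) : ZMod n) = 0 ∧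
      ((FreeGroup.autMatHom (FreeGroup.commAut c d) 1 0 : ℤ) : ZMod n) = 0 ∧
      ((FreeGroup.autMatHom (FreeGroup.commAut c d) 1 1 : ℤ) : ZMod n) = 1
    simp only [FreeGroup.autMatHom_commAut]
    simp only [Matrix.of_apply, Matrix.cons_val', Matrix.cons_val_zero, Matrix.cons_val_one,
      Matrix.cons_val_fin_one]
    push_cast
    refine ⟨?_, ?_, ?_, ?_⟩
    · linear_combination (1 + c * d : ZMod n) * hz
    · linear_combination (-c : ZMod n) * hz
    · linear_combination (d : ZMod n) * hz
    · linear_combination -hz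
  obtain ⟨γ, hγ, hA⟩ := hsub hmem
  exact FreeGroup.not_mem_stabSet_UD hcd h3 h4 hA.symm hγ
end

section
/- The Veech group Γ(U_L) of the origami L(2,3) is not a congruence subgroup of SL₂(ℤ). -/
namespace FreeGroup

variable {α : Type*} [DecidableEq α]

theorem norm_mk_of_isReduced {l : List (α × Bool)} (h : IsReduced l) :
    norm (mk l) = l.length := by
  rw [norm, toWord_mk, h.reduce_eq]

/-- Two reduced words split off their longest common prefix. -/
theorem exists_common_initial_segment :
    ∀ l₁ l₂ : List (α × Bool), IsReduced l₁ → IsReduced l₂ →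
      ∃ p s t, l₁ = p ++ s ∧ l₂ = p ++ t ∧ IsReduced (invRev s ++ t) ∧
        ∀ j, j ≤ l₁.length → j ≤ l₂.length → l₁.take j = l₂.take j → j ≤ p.length
  | [], l₂, _, h₂ => ⟨[], [], l₂, by simp, by simp, by simpa [invRev] using h₂, by simp⟩
  | a :: l₁, [], h₁, _ => by
      refine ⟨[], a :: l₁, [], by simp, by simp, ?_, by simp⟩
      rw [List.append_nil, isReduced_iff_reduce_eq, reduce_invRev, h₁.reduce_eq]
  | a :: l₁, b :: l₂, h₁, h₂ => by
      by_cases hab : a = b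
      · subst hab
        obtain ⟨p, s, t, rfl, rfl, hr, hj⟩ := exists_common_initial_segment l₁ l₂
          (List.IsChain.tail h₁) (List.IsChain.tail h₂)
        refine ⟨a :: p, s, t, by simp, by simp, hr, ?_⟩
        rintro (_ | j) h h' he
        · simp
        · simp only [List.take_succ_cons, List.cons.injEq, true_and] at he
          simp only [List.length_cons, add_le_add_iff_right] at h h' ⊢
          exact hj j h h' he
      · refine ⟨[], a :: l₁, b :: l₂, by simp, by simp, ?_, ?_⟩
        · have h₁' : IsReduced (invRev (a :: l₁)) := by
            rw [isReduced_iff_reduce_eq, reduce_invRev, h₁.reduce_eq]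
          refine List.IsChain.append h₁' h₂ ?_
          rintro c hc d hd
          simp [invRev] at hc hd
          subst hc hd
          intro h
          by_contra h2
          exact hab (Prod.ext h (by revert h2; cases a.2 <;> cases b.2 <;> simp))
        · rintro (_ | j) h h' he
          · simp
          · simp [hab] at he

theorem exists_norm_inv_mul (a b : FreeGroup α) :
    ∃ k, norm (a⁻¹ * b) + 2 * k = norm a + norm b ∧ a.toWord.take k = b.toWord.take k ∧
      ∀ j, j ≤ norm a → j ≤ norm b → a.toWord.take j = b.toWord.take j → j ≤ k := by
  obtain ⟨p, s, t, hs, ht, hr, hj⟩ :=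
    exists_common_initial_segment a.toWord b.toWord isReduced_toWord isReduced_toWord
  refine ⟨p.length, ?_, by simp [hs, ht], hj⟩
  have ha : a = mk (p ++ s) := by rw [← hs, mk_toWord]
  have hb : b = mk (p ++ t) := by rw [← ht, mk_toWord]
  have : a⁻¹ * b = mk (invRev s ++ t) := by
    rw [ha, hb, ← mul_mk, ← mul_mk, ← mul_mk, ← inv_mk]; group
  rw [this, norm_mk_of_isReduced hr, norm, norm, hs, ht]
  simp only [List.length_append, invRev_length]
  omega

/-- The Gromov product of the word metric is an ultrametric. -/
theorem norm_inv_mul_add_le {a b d : FreeGroup α} {j : ℕ}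
    (h₁ : norm (a⁻¹ * d) + j ≤ norm a + norm d) (h₂ : norm (d⁻¹ * b) + j ≤ norm d + norm b) :
    norm (a⁻¹ * b) + j ≤ norm a + norm b := by
  obtain ⟨k, hk, hk', -⟩ := exists_norm_inv_mul a d
  obtain ⟨m, hm, hm', -⟩ := exists_norm_inv_mul d b
  obtain ⟨n, hn, -, hn'⟩ := exists_norm_inv_mul a b
  have t₁ : norm d ≤ norm a + norm (a⁻¹ * d) := by simpa using norm_mul_le a (a⁻¹ * d)
  have t₂ : norm a ≤ norm (a⁻¹ * d) + norm d := by
    have := norm_mul_le d (a⁻¹ * d)⁻¹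
    rw [norm_inv_eq] at this
    simp at this; omega
  have t₃ : norm b ≤ norm d + norm (d⁻¹ * b) := by simpa using norm_mul_le d (d⁻¹ * b)
  have t₄ : norm d ≤ norm (d⁻¹ * b) + norm b := by
    have := norm_mul_le b (d⁻¹ * b)⁻¹
    rw [norm_inv_eq] at this
    simp at this; omega
  have e₁ := congrArg (List.take (min k m)) hk'
  have e₂ := congrArg (List.take (min k m)) hm'
  rw [List.take_take, List.take_take, min_eq_left (min_le_left _ _)] at e₁
  rw [List.take_take, List.take_take, min_eq_left (min_le_right _ _)] at e₂
  have := hn' (min k m) (by omega) (by omega) (e₁.trans e₂)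
  omega

theorem even_norm_mul (a b : FreeGroup α) : ∃ k, norm (a * b) + 2 * k = norm a + norm b := by
  obtain ⟨k, hk, -⟩ := exists_norm_inv_mul a⁻¹ b
  exact ⟨k, by simpa using hk⟩

theorem exists_norm_inv_mul_add_eq (g : FreeGroup α) {k : ℕ} (hk : k ≤ norm g) :
    ∃ q, norm q = k ∧ norm (q⁻¹ * g) + k = norm g := by
  have hg : IsReduced g.toWord := isReduced_toWord
  refine ⟨mk (g.toWord.take k), ?_, ?_⟩
  · rw [norm_mk_of_isReduced (List.IsChain.take hg _)]
    simpa [norm] using hk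
  · have : (mk (g.toWord.take k))⁻¹ * g = mk (g.toWord.drop k) := by
      rw [inv_mul_eq_iff_eq_mul, mul_mk, List.take_append_drop, mk_toWord]
    rw [this, norm_mk_of_isReduced (List.IsChain.drop hg _)]
    simp only [List.length_drop, norm] at hk ⊢
    omega

theorem norm_lt_norm_mul_self {g : FreeGroup α} (hg : g ≠ 1) : norm g < norm (g * g) := by
  have h0 := reduceCyclically.reduce_flatten_replicate_succ (isReduced_toWord (x := g)) 0
  have h1 := reduceCyclically.reduce_flatten_replicate_succ (isReduced_toWord (x := g)) 1
  have e0 : norm g = (reduce (List.replicate (0 + 1) g.toWord).flatten).length := by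
    simp [norm]
  have e1 : norm (g * g) = (reduce (List.replicate (1 + 1) g.toWord).flatten).length := by
    rw [norm, toWord_mul]; simp [List.replicate]
  rw [e0, e1, h0, h1]
  have hne : reduceCyclically g.toWord ≠ [] := by
    intro h
    have h2 := reduceCyclically.conj_conjugator_reduceCyclically g.toWord
    rw [h, List.append_nil] at h2
    rw [← mk_toWord (x := g), ← h2, ← mul_mk, ← inv_mk, mul_inv_cancel] at hg
    exact hg rfl
  have := List.length_pos_iff.2 hne
  simp [List.replicate]
  omega

end FreeGroup

namespace FreeGroup

variable {α β : Type*} [DecidableEq α]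

/-- If no letter cancels half of its neighbour from both sides, then the cancellation in a reduced
product only involves adjacent factors. -/
theorem norm_mul_prod_add (g : β × Bool → FreeGroup α)
    (hg : ∀ a b c, (a.1 = b.1 → a.2 = b.2) → (b.1 = c.1 → b.2 = c.2) →
      norm (g a) + norm (g c) < norm (g a * g b) + norm (g b * g c)) :
    ∀ (L : List (β × Bool)) (c b : β × Bool), IsReduced (c :: b :: L) →
      norm (g c * ((b :: L).map g).prod) + norm (g b) =
        norm ((b :: L).map g).prod + norm (g c * g b)
  | [], c, b, _ => by simp [add_comm]
  | d :: L, c, b, h => by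
      have ih := norm_mul_prod_add g hg L b d (List.IsChain.tail h)
      rw [isReduced_cons_cons, isReduced_cons_cons] at h
      have h2 := hg c b d h.1 h.2.1
      rw [List.map_cons, List.prod_cons]
      generalize ((d :: L).map g).prod = w at *
      obtain ⟨k, hk⟩ := even_norm_mul (g c) (g b)
      obtain ⟨m, hm⟩ := even_norm_mul (g c) (g b * w)
      obtain ⟨n, hn⟩ := even_norm_mul (g b) (g d)
      have key₁ : norm (g c * (g b * w)) + 2 * k ≤ norm (g c) + norm (g b * w) := by
        have := norm_inv_mul_add_le (a := (g c)⁻¹) (b := g b * w) (d := g b) (j := 2 * k)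
          (by simpa using hk.le) (by rw [inv_mul_cancel_left]; omega)
        simpa using this
      have key₂ : m ≤ k := by
        by_contra! hkm
        have := norm_inv_mul_add_le (a := (g c)⁻¹) (b := g b) (d := g b * w) (j := 2 * (k + 1))
          (by rw [inv_inv, norm_inv_eq]; omega)
          (by rw [mul_inv_rev, inv_mul_cancel_right, norm_inv_eq]; omega)
        rw [inv_inv, norm_inv_eq] at this
        omega
      omega

theorem length_eq_one_of_norm_prod_eq_one (g : β × Bool → FreeGroup α)
    (hl : ∀ a b, (a.1 = b.1 → a.2 = b.2) → norm (g a) ≤ norm (g a * g b))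
    (hr : ∀ a b, (a.1 = b.1 → a.2 = b.2) → norm (g b) ≤ norm (g a * g b))
    (hg : ∀ a b c, (a.1 = b.1 → a.2 = b.2) → (b.1 = c.1 → b.2 = c.2) →
      norm (g a) + norm (g c) < norm (g a * g b) + norm (g b * g c))
    (h1 : ∀ a, g a ≠ 1) :
    ∀ L : List (β × Bool), IsReduced L → norm (L.map g).prod ≤ 1 → L.length ≤ 1
  | [], _, _ => by simp
  | [_], _, _ => by simp
  | c :: b :: L, h, hn => by
      exfalso
      have key := norm_mul_prod_add g hg L c b h
      have ih := length_eq_one_of_norm_prod_eq_one g hl hr hg h1 (b :: L)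
        (List.IsChain.tail h)
      rw [isReduced_cons_cons] at h
      have h2 := hr c b h.1
      rw [List.map_cons, List.prod_cons] at hn
      have h3 := ih (by omega)
      obtain rfl : L = [] := by simpa using h3
      have hb := mt norm_eq_zero.1 (h1 b)
      have hc := mt norm_eq_zero.1 (h1 c)
      have := hl c b h.1
      obtain ⟨k, hk⟩ := even_norm_mul (g c) (g b)
      simp only [List.map_cons, List.map_nil, List.prod_cons, List.prod_nil, mul_one] at *
      omega

/-- The conjugation and multiplication shortening a pair in which `b` is cancelled half from the
left and half from the right by `a`. -/
theorem exists_conj_lt {a b : FreeGroup α} (hb : b ≠ 1) (h₁ : norm (a * b) = norm a)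
    (h₂ : norm (b * a) = norm a) (h₃ : norm b ≤ norm a) :
    ∃ q, norm (q⁻¹ * b * q) + norm (q⁻¹ * (a * b) * q) < norm b + norm a := by
  obtain ⟨k, hk⟩ := even_norm_mul a b
  obtain ⟨q, hq, hq'⟩ := exists_norm_inv_mul_add_eq b⁻¹ (k := k) (by rw [norm_inv_eq]; omega)
  have hb0 := mt norm_eq_zero.1 hb
  rw [norm_inv_eq] at hq'
  have hp : norm (b * q) = k := by
    rw [← norm_inv_eq, mul_inv_rev]; omega
  have e₁ := norm_inv_mul_add_le (a := q) (b := a) (d := b⁻¹) (j := 2 * k)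
    (by rw [norm_inv_eq]; omega) (by rw [inv_inv, norm_inv_eq]; omega)
  have e₂ := norm_inv_mul_add_le (a := a⁻¹) (b := b * q) (d := b) (j := 2 * k)
    (by rw [inv_inv, norm_inv_eq]; omega) (by rw [inv_mul_cancel_left]; omega)
  have e₃ : norm a ≤ k + norm (q⁻¹ * a) := by
    simpa [hq] using norm_mul_le q (q⁻¹ * a)
  have e₄ : norm (a⁻¹ * q) = norm (q⁻¹ * a) := by
    rw [← norm_inv_eq, mul_inv_rev, inv_inv]
  have e₅ := norm_inv_mul_add_le (a := a⁻¹ * q) (b := b * q) (d := a⁻¹) (j := 2 * k)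
    (by rw [mul_inv_rev, inv_mul_cancel_right, norm_inv_eq, norm_inv_eq]; omega)
    e₂
  refine ⟨q, ?_⟩
  have e₆ : q⁻¹ * (a * b) * q = (a⁻¹ * q)⁻¹ * (b * q) := by group
  have e₇ := norm_mul_le q⁻¹ (b * q)
  rw [norm_inv_eq] at e₇
  rw [e₆, mul_assoc]
  omega

end FreeGroup

theorem autF2_ext {f g : MulAut F2} (hx : f xg = g xg) (hy : f yg = g yg) : f = g := by
  have : f.toMonoidHom = g.toMonoidHom := by
    ext i
    fin_cases i
    exacts [hx, hy]
  exact MulEquiv.toMonoidHom_injective this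

/-- The automorphism `x ↦ y`, `y ↦ x`. -/
def swapAut : MulAut F2 := FreeGroup.freeGroupCongr (Equiv.swap 0 1)

/-- The automorphism `x ↦ x⁻¹`, `y ↦ y`. -/
def invAut : MulAut F2 :=
  MonoidHom.toMulEquiv (FreeGroup.lift ![xg⁻¹, yg]) (FreeGroup.lift ![xg⁻¹, yg])
    (by ext i; fin_cases i <;> simp [xg, yg]) (by ext i; fin_cases i <;> simp [xg, yg])

/-- The automorphism `x ↦ x`, `y ↦ y * x ^ k`. -/
def shearAut (k : ℤ) : MulAut F2 :=
  MonoidHom.toMulEquiv (FreeGroup.lift ![xg, yg * xg ^ k]) (FreeGroup.lift ![xg, yg * xg ^ (-k)])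
    (by ext i; fin_cases i <;> simp [xg, yg]) (by ext i; fin_cases i <;> simp [xg, yg])

@[simp] theorem swapAut_x : swapAut xg = yg := by simp [swapAut, xg, yg]
@[simp] theorem swapAut_y : swapAut yg = xg := by simp [swapAut, xg, yg]
@[simp] theorem invAut_x : invAut xg = xg⁻¹ := by simp [invAut, xg]
@[simp] theorem invAut_y : invAut yg = yg := by simp [invAut, yg]
@[simp] theorem shearAut_x (k : ℤ) : shearAut k xg = xg := by simp [shearAut, xg]
@[simp] theorem shearAut_y (k : ℤ) : shearAut k yg = yg * xg ^ k := by simp [shearAut, yg]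

theorem exists_aut_letters {Q : Subgroup (MulAut F2)} (hs : swapAut ∈ Q) (hi : invAut ∈ Q)
    (c b : Fin 2 × Bool) (h : c.1 ≠ b.1) :
    ∃ δ ∈ Q, δ xg = FreeGroup.mk [c] ∧ δ yg = FreeGroup.mk [b] := by
  have hx : FreeGroup.mk [((0 : Fin 2), true)] = xg := rfl
  have hy : FreeGroup.mk [((1 : Fin 2), true)] = yg := rfl
  have hx' : FreeGroup.mk [((0 : Fin 2), false)] = xg⁻¹ := rfl
  have hy' : FreeGroup.mk [((1 : Fin 2), false)] = yg⁻¹ := rfl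
  have hj : swapAut * invAut * swapAut ∈ Q := Q.mul_mem (Q.mul_mem hs hi) hs
  obtain ⟨i, p⟩ := c
  obtain ⟨j, q⟩ := b
  fin_cases i <;> fin_cases j <;> cases p <;> cases q <;>
    simp [hx, hy, hx', hy'] at h ⊢
  · exact ⟨_, Q.mul_mem hi hj, by simp⟩
  · exact ⟨_, hi, by simp⟩
  · exact ⟨_, hj, by simp⟩
  · exact ⟨_, Q.one_mem, by simp⟩
  · exact ⟨_, Q.mul_mem hs (Q.mul_mem hi hj), by simp⟩
  · exact ⟨_, Q.mul_mem hs hi, by simp⟩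
  · exact ⟨_, Q.mul_mem hs hj, by simp⟩
  · exact ⟨_, hs, by simp⟩

namespace FreeGroup

theorem norm_le_one_of_minimal {Q : Subgroup (MulAut F2)} (hc : ∀ w, MulAut.conj w ∈ Q)
    (hs : swapAut ∈ Q) (hi : invAut ∈ Q) (ht : shearAut 1 ∈ Q) (γ : MulAut F2)
    (hmin : ∀ δ ∈ Q, norm (γ xg) + norm (γ yg) ≤ norm (γ (δ xg)) + norm (γ (δ yg)))
    (w : F2) (hw : norm (γ w) ≤ 1) : norm w ≤ 1 := by
  let g : Fin 2 × Bool → F2 := fun c => γ (mk [c])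
  have hg : ∀ c b, c.1 ≠ b.1 → norm (g c) + norm (g b) = norm (γ xg) + norm (γ yg) := by
    have e : ∀ i b, norm (g (i, b)) = norm (γ (of i)) := by
      rintro i (_ | _)
      · rw [← norm_inv_eq, ← _root_.map_inv]; rfl
      · rfl
    rintro ⟨i, p⟩ ⟨j, q⟩ h
    rw [e, e]
    fin_cases i <;> fin_cases j <;> simp [xg, yg, add_comm] at h ⊢
  have hbar : ∀ c : Fin 2 × Bool, g (c.1, !c.2) = (g c)⁻¹ := by
    rintro ⟨i, p⟩
    change γ _ = (γ _)⁻¹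
    rw [← _root_.map_inv, inv_mk]
    rfl
  have h1 : ∀ c, g c ≠ 1 := by
    intro c h
    have := (_root_.map_eq_one_iff γ γ.injective).1 h
    rw [← toWord_inj, toWord_mk] at this
    simp at this
  have hrc : ∀ c b, c.1 ≠ b.1 → norm (g b) ≤ norm (g b * g c) := by
    intro c b h
    obtain ⟨δ, hδ, hx, hy⟩ := exists_aut_letters hs hi c b h
    have := hmin _ (Q.mul_mem hδ ht)
    rw [← hg c b h] at this
    simp only [MulAut.mul_apply, shearAut_x, shearAut_y, zpow_one, _root_.map_mul, hx, hy] at this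
    exact Nat.le_of_add_le_add_left this
  have hlc : ∀ c b, c.1 ≠ b.1 → norm (g b) ≤ norm (g c * g b) := by
    intro c b h
    have := hrc (c.1, !c.2) (b.1, !b.2) h
    rw [hbar, hbar, norm_inv_eq, ← mul_inv_rev, norm_inv_eq] at this
    exact this
  have heq : ∀ a b : Fin 2 × Bool, (a.1 = b.1 → a.2 = b.2) → a.1 = b.1 → a = b :=
    fun a b h h' => Prod.ext h' (h h')
  have hl : ∀ a b, (a.1 = b.1 → a.2 = b.2) → norm (g a) ≤ norm (g a * g b) := by
    intro a b h
    by_cases hab : a.1 = b.1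
    · obtain rfl := heq _ _ h hab
      exact (norm_lt_norm_mul_self (h1 a)).le
    · exact hrc b a (Ne.symm hab)
  have hr : ∀ a b, (a.1 = b.1 → a.2 = b.2) → norm (g b) ≤ norm (g a * g b) := by
    intro a b h
    by_cases hab : a.1 = b.1
    · obtain rfl := heq _ _ h hab
      exact (norm_lt_norm_mul_self (h1 a)).le
    · exact hlc a b hab
  have h2 : ∀ a b c, (a.1 = b.1 → a.2 = b.2) → (b.1 = c.1 → b.2 = c.2) →
      norm (g a) + norm (g c) < norm (g a * g b) + norm (g b * g c) := by
    intro a b c hab hbc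
    by_contra! hle
    have e₁ := hl a b hab
    have e₂ := hr b c hbc
    have n₁ : a.1 ≠ b.1 := by
      intro h
      obtain rfl := heq _ _ hab h
      have := norm_lt_norm_mul_self (h1 a)
      omega
    have n₂ : b.1 ≠ c.1 := by
      intro h
      obtain rfl := heq _ _ hbc h
      have := norm_lt_norm_mul_self (h1 b)
      omega
    have n₃ : c.1 = a.1 := by omega
    by_cases n₄ : c.2 = a.2
    · obtain rfl : c = a := Prod.ext n₃ n₄
      obtain ⟨q, hq⟩ := exists_conj_lt (a := g c) (b := g b) (h1 b) (by omega) (by omega)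
        (by have := hr c b hab; omega)
      obtain ⟨δ, hδ, hx, hy⟩ := exists_aut_letters hs hi b c n₂
      have := hmin _ (Q.mul_mem (hc (γ.symm q⁻¹)) (Q.mul_mem hδ ht))
      rw [← hg b c n₂] at this
      have hconj : ∀ v, γ (MulAut.conj (γ.symm q⁻¹) v) = q⁻¹ * γ v * q := by
        intro v
        rw [MulAut.conj_apply, _root_.map_mul, _root_.map_mul, MulEquiv.apply_symm_apply,
          _root_.map_inv, MulEquiv.apply_symm_apply, inv_inv]
      simp only [MulAut.mul_apply, shearAut_x, shearAut_y, zpow_one, hconj, hx] at this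
      rw [_root_.map_mul, _root_.map_mul, hx, hy] at this
      simp only [g] at hq this
      omega
    · obtain rfl : c = (a.1, !a.2) := Prod.ext n₃ (by revert n₄; cases c.2 <;> cases a.2 <;> simp)
      rw [hbar, norm_inv_eq] at *
      have := norm_inv_mul_add_le (a := (g b)⁻¹) (b := g b) (d := (g a)⁻¹) (j := norm (g b))
        (by rw [inv_inv, norm_inv_eq, norm_inv_eq]; omega)
        (by rw [inv_inv, norm_inv_eq]; omega)
      rw [inv_inv, norm_inv_eq] at this
      have := norm_lt_norm_mul_self (h1 b)
      omega
  have hprod : ∀ L : List (Fin 2 × Bool), (L.map g).prod = γ (mk L) := by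
    intro L
    induction L with
    | nil => exact (_root_.map_one γ).symm
    | cons c L ih =>
      rw [List.map_cons, List.prod_cons, ih, ← List.singleton_append, ← mul_mk, _root_.map_mul]
  exact length_eq_one_of_norm_prod_eq_one g hl hr h2 h1 w.toWord isReduced_toWord
    (by rw [hprod, mk_toWord]; exact hw)

theorem exists_eq_mk_singleton {w : F2} (h1 : w ≠ 1) (h : norm w ≤ 1) : ∃ c, w = mk [c] := by
  have h0 := mt norm_eq_zero.1 h1
  obtain ⟨c, hc⟩ := List.length_eq_one_iff.1 (show w.toWord.length = 1 by unfold norm at *; omega)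
  exact ⟨c, by rw [← hc, mk_toWord]⟩

end FreeGroup

/-- The automorphism group of `F₂` is generated by the inner automorphisms and the elementary
Nielsen automorphisms. -/
theorem autF2_generators {Q : Subgroup (MulAut F2)} (hc : ∀ w, MulAut.conj w ∈ Q)
    (hs : swapAut ∈ Q) (hi : invAut ∈ Q) (ht : shearAut 1 ∈ Q) : Q = ⊤ := by
  rw [eq_top_iff]
  rintro γ -
  obtain ⟨δ, hδ, hmin⟩ := (measure fun δ : MulAut F2 =>
    FreeGroup.norm (γ (δ xg)) + FreeGroup.norm (γ (δ yg))).wf.has_min (Q : Set (MulAut F2))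
    ⟨1, Q.one_mem⟩
  have key := FreeGroup.norm_le_one_of_minimal hc hs hi ht (γ * δ) fun ε hε =>
    not_lt.1 (hmin (δ * ε) (Q.mul_mem hδ hε))
  have hex : ∀ i : Fin 2, ∃ c, (γ * δ)⁻¹ (FreeGroup.of i) = FreeGroup.mk [c] := fun i =>
    FreeGroup.exists_eq_mk_singleton (by simp [FreeGroup.of_ne_one])
      (key _ (by rw [MulAut.apply_inv_self, FreeGroup.norm_of]))
  obtain ⟨c, hcx⟩ := hex 0
  obtain ⟨b, hby⟩ := hex 1
  have hcb : c.1 ≠ b.1 := by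
    intro h
    have h2 : (γ * δ)⁻¹ yg = (γ * δ)⁻¹ xg ∨ (γ * δ)⁻¹ yg = (γ * δ)⁻¹ xg⁻¹ := by
      rw [map_inv, xg, yg, hcx, hby]
      obtain ⟨i, p⟩ := c
      obtain ⟨j, q⟩ := b
      obtain rfl : i = j := h
      cases p <;> cases q <;> simp [FreeGroup.invRev]
    rw [EmbeddingLike.apply_eq_iff_eq, EmbeddingLike.apply_eq_iff_eq] at h2
    revert h2
    decide
  obtain ⟨ε, hε, hx, hy⟩ := exists_aut_letters hs hi c b hcb
  have : (γ * δ)⁻¹ = ε := autF2_ext (hcx.trans hx.symm) (hby.trans hy.symm)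
  have h3 : γ = ε⁻¹ * δ⁻¹ := by rw [← this]; group
  rw [h3]
  exact Q.mul_mem (Q.inv_mem hε) (Q.inv_mem hδ)

theorem toAdd_expSum_apply (γ : MulAut F2) (i : Fin 2) (w : F2) :
    (expSum i (γ w)).toAdd = ∑ k, autMat γ i k * (expSum k w).toAdd := by
  induction w using FreeGroup.induction_on with
  | C1 => simp
  | of j => fin_cases j <;> simp [expSum, autMat]
  | inv_of j ih => simp only [map_inv, toAdd_inv, ih, mul_neg, Finset.sum_neg_distrib]
  | mul v w hv hw => simp only [map_mul, toAdd_mul, hv, hw, mul_add, Finset.sum_add_distrib]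

theorem autMat_mul (γ δ : MulAut F2) : autMat (γ * δ) = autMat γ * autMat δ := by
  ext i j
  exact toAdd_expSum_apply γ i _

theorem autMat_one : autMat (1 : MulAut F2) = 1 := by
  ext i j
  fin_cases i <;> fin_cases j <;> simp [autMat, expSum]

theorem autMat_conj (w : F2) : autMat (MulAut.conj w) = 1 := by
  rw [← autMat_one]
  ext i j
  simp [autMat]

theorem autMat_swapAut : autMat swapAut = !![0, 1; 1, 0] := by
  ext i j
  fin_cases i <;> fin_cases j <;> simp [autMat, expSum, swapAut]

theorem autMat_invAut : autMat invAut = !![-1, 0; 0, 1] := by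
  ext i j
  fin_cases i <;> fin_cases j <;> simp [autMat, expSum, invAut, xg, yg]

theorem autMat_shearAut (k : ℤ) : autMat (shearAut k) = !![1, k; 0, 1] := by
  ext i j
  fin_cases i <;> fin_cases j <;> simp [autMat, expSum, shearAut, xg, yg]

theorem exists_normal_form {G : Type*} [Group G] {s i t d : G} (hs : s * s = 1) (hi : i * i = 1)
    (hit : i * t * i = t⁻¹) (hil : i * (s * t * s) * i = (s * t * s)⁻¹)
    (hlt : s * t * s * t⁻¹ = t * d) (hd : d ∈ Subgroup.closure {s, i}) {g : G}
    (hg : g ∈ Subgroup.closure {s, i, t}) :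
    ∃ d₁ ∈ Subgroup.closure {s, i}, ∃ m ∈ Submonoid.closure {t, s * t * s},
      ∃ d₂ ∈ Subgroup.closure {s, i}, g = d₁ * m * d₂ := by
  set D := Subgroup.closure {s, i}
  set M := Submonoid.closure {t, s * t * s}
  have hsD : s ∈ D := Subgroup.subset_closure (by simp)
  have hiD : i ∈ D := Subgroup.subset_closure (by simp)
  have htM : t ∈ M := Submonoid.subset_closure (by simp)
  have hlM : s * t * s ∈ M := Submonoid.subset_closure (by simp)
  have hs' : s⁻¹ = s := inv_eq_of_mul_eq_one_right hs
  have hi' : i⁻¹ = i := inv_eq_of_mul_eq_one_right hi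
  have hss (z : G) : s * (s * z) = z := by rw [← mul_assoc, hs, one_mul]
  have hii (z : G) : i * (i * z) = z := by rw [← mul_assoc, hi, one_mul]
  have hlt' : t * (s * t * s)⁻¹ = s * t * s * (s * d * s) := by
    have : t * (s * t * s)⁻¹ = s * (s * t * s * t⁻¹) * s := by
      simp only [mul_inv_rev, hs', mul_assoc, hss]
    rw [this, hlt]
    simp only [mul_assoc, hss]
  have hit' : i * t⁻¹ * i = t := by rw [← hit]; simp only [mul_assoc, hii, hi, mul_one]
  have hil' : i * (s * t * s)⁻¹ * i = s * t * s := by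
    rw [← hil]; simp only [mul_assoc, hii, hi, mul_one]
  let X : Set G := {t, t⁻¹, s * t * s, (s * t * s)⁻¹}
  have hXa : ∀ a ∈ ({s, i} : Set G), a⁻¹ = a ∧ ∀ x ∈ X, a * x * a ∈ X := by
    rintro a (rfl | rfl)
    · refine ⟨hs', ?_⟩
      rintro x (rfl | rfl | rfl | rfl) <;> simp [X, hs', mul_assoc, hss, hs]
    · refine ⟨hi', ?_⟩
      rintro x (rfl | rfl | rfl | rfl)
      · rw [hit]; simp [X]
      · rw [hit']; simp [X]
      · rw [hil]; simp [X]
      · rw [hil']; simp [X]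
  have hX : ∀ e ∈ D, ∀ x ∈ X, e * x * e⁻¹ ∈ X := by
    intro e he
    induction he using Subgroup.closure_induction_left with
    | one => simp
    | mul_left a ha e he ih =>
      intro x hx
      have := (hXa a ha).2 _ (ih x hx)
      simpa only [mul_inv_rev, (hXa a ha).1, mul_assoc] using this
    | inv_mul_cancel a ha e he ih =>
      intro x hx
      have := (hXa a ha).2 _ (ih x hx)
      simpa only [mul_inv_rev, inv_inv, (hXa a ha).1, mul_assoc] using this
  have key : ∀ m ∈ M, ∀ x ∈ X, ∃ d₁ ∈ D, ∃ m' ∈ M, ∃ d₂ ∈ D, m * x = d₁ * m' * d₂ := by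
    intro m hm x hx
    have pos (m : G) (hm : m ∈ M) (e : G) (he : e ∈ D) :
        ∃ d₁ ∈ D, ∃ m' ∈ M, ∃ d₂ ∈ D, m * e = d₁ * m' * d₂ :=
      ⟨1, D.one_mem, m, hm, e, he, by rw [one_mul]⟩
    have pos' (m : G) (hm : m ∈ M) : ∃ d₁ ∈ D, ∃ m' ∈ M, ∃ d₂ ∈ D, m = d₁ * m' * d₂ := by
      simpa using pos m hm 1 D.one_mem
    induction hm using Submonoid.closure_induction_right with
    | one =>
      rw [one_mul]
      rcases hx with rfl | rfl | rfl | rfl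
      · exact pos' _ htM
      · exact ⟨i, hiD, t, htM, i, hiD, hit.symm⟩
      · exact pos' _ hlM
      · exact ⟨i, hiD, _, hlM, i, hiD, hil.symm⟩
    | mul_right m hm a ha ih =>
      have haM : m * a ∈ M := mul_mem hm (Submonoid.subset_closure ha)
      rcases hx with rfl | rfl | rfl | rfl
      · exact pos' _ (mul_mem haM htM)
      · rcases ha with rfl | rfl
        · rw [mul_inv_cancel_right]; exact pos' _ hm
        · rw [mul_assoc, hlt, ← mul_assoc]; exact pos _ (mul_mem hm htM) _ hd
      · exact pos' _ (mul_mem haM hlM)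
      · rcases ha with rfl | rfl
        · rw [mul_assoc, hlt', ← mul_assoc]
          exact pos _ (mul_mem hm hlM) _ (mul_mem (mul_mem hsD hd) hsD)
        · rw [mul_inv_cancel_right]; exact pos' _ hm
  have step (g x : G) (hx : x ∈ X)
      (ih : ∃ d₁ ∈ D, ∃ m ∈ M, ∃ d₂ ∈ D, g = d₁ * m * d₂) :
      ∃ d₁ ∈ D, ∃ m ∈ M, ∃ d₂ ∈ D, g * x = d₁ * m * d₂ := by
    obtain ⟨d₁, h₁, m, hm, d₂, h₂, rfl⟩ := ih
    obtain ⟨e₁, k₁, m', hm', e₂, k₂, h⟩ := key m hm _ (hX d₂ h₂ x hx)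
    refine ⟨d₁ * e₁, mul_mem h₁ k₁, m', hm', e₂ * d₂, mul_mem k₂ h₂, ?_⟩
    calc d₁ * m * d₂ * x = d₁ * (m * (d₂ * x * d₂⁻¹)) * d₂ := by group
      _ = _ := by rw [h]; group
  have stepD (g e : G) (he : e ∈ D)
      (ih : ∃ d₁ ∈ D, ∃ m ∈ M, ∃ d₂ ∈ D, g = d₁ * m * d₂) :
      ∃ d₁ ∈ D, ∃ m ∈ M, ∃ d₂ ∈ D, g * e = d₁ * m * d₂ := by
    obtain ⟨d₁, h₁, m, hm, d₂, h₂, rfl⟩ := ih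
    exact ⟨d₁, h₁, m, hm, d₂ * e, mul_mem h₂ he, mul_assoc _ _ _⟩
  induction hg using Subgroup.closure_induction_right with
  | one => exact ⟨1, D.one_mem, 1, M.one_mem, 1, D.one_mem, by simp⟩
  | mul_right g hg a ha ih =>
    rcases ha with rfl | rfl | rfl
    · exact stepD _ _ hsD ih
    · exact stepD _ _ hiD ih
    · exact step _ _ (by simp [X]) ih
  | mul_inv_cancel g hg a ha ih =>
    rcases ha with rfl | rfl | rfl
    · exact stepD _ _ (inv_mem hsD) ih
    · exact stepD _ _ (inv_mem hiD) ih
    · exact step _ _ (by simp [X]) ih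

instance normal_range_conj : (MulAut.conj : F2 →* MulAut F2).range.Normal where
  conj_mem := by
    rintro _ ⟨w, rfl⟩ γ
    refine ⟨γ w, ?_⟩
    ext v
    simp

theorem swapAut_mul_swapAut : swapAut * swapAut = 1 := by
  apply autF2_ext <;> simp

theorem invAut_mul_invAut : invAut * invAut = 1 := by
  apply autF2_ext <;> simp

theorem swapAut_inv : swapAut⁻¹ = swapAut := inv_eq_of_mul_eq_one_right swapAut_mul_swapAut

theorem invAut_inv : invAut⁻¹ = invAut := inv_eq_of_mul_eq_one_right invAut_mul_invAut

theorem sum_abs_autMat_of_mem_closure {γ : MulAut F2}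
    (hγ : γ ∈ Subgroup.closure {swapAut, invAut}) : ∑ i, ∑ j, |autMat γ i j| = 2 := by
  have step (A : Matrix (Fin 2) (Fin 2) ℤ) {δ : MulAut F2}
      (hδ : δ ∈ ({swapAut, invAut} : Set (MulAut F2))) :
      ∑ i, ∑ j, |(A * autMat δ) i j| = ∑ i, ∑ j, |A i j| := by
    rcases hδ with rfl | rfl
    · simp [autMat_swapAut, Matrix.mul_apply, Fin.sum_univ_two]; ring
    · simp [autMat_invAut, Matrix.mul_apply, Fin.sum_univ_two]
  induction hγ using Subgroup.closure_induction_right with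
  | one => simp [autMat_one, Fin.sum_univ_two]
  | mul_right γ hγ δ hδ ih => rw [autMat_mul, step _ hδ, ih]
  | mul_inv_cancel γ hγ δ hδ ih =>
    rw [← step _ hδ, ← autMat_mul, inv_mul_cancel_right, ih]

theorem eq_one_of_autMat_eq_one_of_mem_closure {γ : MulAut F2}
    (hγ : γ ∈ Subgroup.closure {swapAut, invAut}) (h : autMat γ = 1) : γ = 1 := by
  have letters : ∀ c, ∃ c', γ (FreeGroup.mk [c]) = FreeGroup.mk [c'] := by
    have swap_letter (c : Fin 2 × Bool) :
        ∃ c', swapAut (FreeGroup.mk [c]) = FreeGroup.mk [c'] := by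
      exact ⟨_, FreeGroup.map.mk⟩
    have inv_letter (c : Fin 2 × Bool) :
        ∃ c', invAut (FreeGroup.mk [c]) = FreeGroup.mk [c'] := by
      obtain ⟨j, b⟩ := c
      fin_cases j <;> cases b
      · exact ⟨(0, true), by simp [invAut]; rfl⟩
      · exact ⟨(0, false), by simp [invAut]; rfl⟩
      · exact ⟨(1, false), by simp [invAut]; rfl⟩
      · exact ⟨(1, true), by simp [invAut]; rfl⟩
    clear h
    induction hγ using Subgroup.closure_induction_right with
    | one => exact fun c => ⟨c, rfl⟩
    | mul_right γ hγ δ hδ ih =>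
      intro c
      rcases hδ with rfl | rfl
      · obtain ⟨c', h⟩ := swap_letter c
        rw [MulAut.mul_apply, h]
        exact ih c'
      · obtain ⟨c', h⟩ := inv_letter c
        rw [MulAut.mul_apply, h]
        exact ih c'
    | mul_inv_cancel γ hγ δ hδ ih =>
      intro c
      rcases hδ with rfl | rfl
      · obtain ⟨c', h⟩ := swap_letter c
        rw [swapAut_inv, MulAut.mul_apply, h]
        exact ih c'
      · obtain ⟨c', h⟩ := inv_letter c
        rw [invAut_inv, MulAut.mul_apply, h]
        exact ih c'
  have fix (j : Fin 2) : γ (FreeGroup.of j) = FreeGroup.of j := by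
    obtain ⟨⟨k, b⟩, hk⟩ := letters (j, true)
    have h0 := congrFun (congrFun h 0) j
    have h1 := congrFun (congrFun h 1) j
    change (expSum 0 (γ (FreeGroup.mk [(j, true)]))).toAdd = _ at h0
    change (expSum 1 (γ (FreeGroup.mk [(j, true)]))).toAdd = _ at h1
    change γ (FreeGroup.mk [(j, true)]) = _
    rw [hk] at h0 h1 ⊢
    fin_cases j <;> fin_cases k <;> cases b <;> simp [expSum] at h0 h1 ⊢ <;>
      first | rfl | exact absurd h0 (by decide) | exact absurd h1 (by decide)
  exact autF2_ext (fix 0) (fix 1)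

theorem autMat_mem_closure_nonneg {γ : MulAut F2}
    (hγ : γ ∈ Submonoid.closure {shearAut 1, swapAut * shearAut 1 * swapAut}) :
    (∀ i j, 0 ≤ autMat γ i j) ∧ (∀ j, 1 ≤ autMat γ 0 j + autMat γ 1 j) ∧
      (γ = 1 ∨ 3 ≤ ∑ i, ∑ j, autMat γ i j) := by
  induction hγ using Submonoid.closure_induction_right with
  | one =>
    simp [autMat_one, Fin.forall_fin_two]
  | mul_right γ hγ δ hδ ih =>
    obtain ⟨h0, h1, -⟩ := ih
    simp only [Fin.forall_fin_two, Fin.sum_univ_two] at h0 h1 ⊢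
    rcases hδ with rfl | rfl <;>
      simp [autMat_mul, autMat_shearAut, autMat_swapAut, Matrix.mul_apply, Fin.sum_univ_two] <;>
      omega

/-- An automorphism of `F₂` acting trivially on the abelianization is inner. -/
theorem exists_eq_conj_of_autMat_eq_one {γ : MulAut F2} (h : autMat γ = 1) :
    ∃ w, γ = MulAut.conj w := by
  let π := QuotientGroup.mk' (MulAut.conj : F2 →* MulAut F2).range
  have hπ {δ ε : MulAut F2} (w : F2) (h : δ = MulAut.conj w * ε) : π δ = π ε := by
    rw [h, map_mul, show π (MulAut.conj w) = 1 from (QuotientGroup.eq_one_iff _).2 ⟨w, rfl⟩,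
      one_mul]
  have hπ' {δ ε : MulAut F2} (h : π δ = π ε) : ∃ w, δ = MulAut.conj w * ε := by
    have : π (δ * ε⁻¹) = 1 := by rw [map_mul, map_inv, h, mul_inv_cancel]
    obtain ⟨w, hw⟩ := (QuotientGroup.eq_one_iff _).1 this
    exact ⟨w, by rw [hw, inv_mul_cancel_right]⟩
  have hgen : π γ ∈ Subgroup.closure {π swapAut, π invAut, π (shearAut 1)} := by
    have : (Subgroup.closure {π swapAut, π invAut, π (shearAut 1)}).comap π = ⊤ := by
      refine autF2_generators (fun w => ?_) ?_ ?_ ?_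
      · rw [Subgroup.mem_comap, show π (MulAut.conj w) = 1 from
          (QuotientGroup.eq_one_iff _).2 ⟨w, rfl⟩]
        exact one_mem _
      all_goals exact Subgroup.subset_closure (by simp)
    rw [← Subgroup.mem_comap, this]
    trivial
  have hmem : π (invAut * swapAut) ∈ Subgroup.closure {π swapAut, π invAut} := by
    rw [map_mul]
    exact mul_mem (Subgroup.subset_closure (by simp)) (Subgroup.subset_closure (by simp))
  have hs : π swapAut * π swapAut = 1 := by
    rw [← map_mul, swapAut_mul_swapAut, map_one]
  have hi : π invAut * π invAut = 1 := by
    rw [← map_mul, invAut_mul_invAut, map_one]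
  have hit : π invAut * π (shearAut 1) * π invAut = (π (shearAut 1))⁻¹ := by
    rw [eq_inv_iff_mul_eq_one]
    simp only [← map_mul]
    rw [← map_one π]
    congr 1
    apply autF2_ext <;> simp
  have hil : π invAut * (π swapAut * π (shearAut 1) * π swapAut) * π invAut =
      (π swapAut * π (shearAut 1) * π swapAut)⁻¹ := by
    rw [eq_inv_iff_mul_eq_one]
    simp only [← map_mul]
    rw [← map_one π]
    refine hπ yg⁻¹ ?_
    apply autF2_ext <;> simp
  have hlt : π swapAut * π (shearAut 1) * π swapAut * (π (shearAut 1))⁻¹ =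
      π (shearAut 1) * π (invAut * swapAut) := by
    rw [mul_inv_eq_iff_eq_mul]
    simp only [← map_mul]
    refine hπ xg ?_
    apply autF2_ext <;> simp [mul_assoc]
  obtain ⟨d₁, h₁, m, hm, d₂, h₂, hγ⟩ := exists_normal_form hs hi hit hil hlt hmem hgen
  have lift {d} (hd : d ∈ Subgroup.closure {π swapAut, π invAut}) :
      ∃ ε ∈ Subgroup.closure {swapAut, invAut}, π ε = d := by
    rwa [← Set.image_pair π, ← MonoidHom.map_closure] at hd
  obtain ⟨e₁, k₁, rfl⟩ := lift h₁
  obtain ⟨e₂, k₂, rfl⟩ := lift h₂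
  obtain ⟨μ, hμ, rfl⟩ : ∃ μ ∈ Submonoid.closure {shearAut 1, swapAut * shearAut 1 * swapAut},
      π μ = m := by
    simp only [← map_mul] at hm
    rwa [← Set.image_pair π, ← MonoidHom.map_mclosure] at hm
  simp only [← map_mul] at hγ
  obtain ⟨w, rfl⟩ := hπ' hγ
  have hmat : autMat e₁ * autMat μ * autMat e₂ = 1 := by
    rw [autMat_mul, autMat_conj, one_mul, autMat_mul, autMat_mul] at h
    exact h
  have hinv (e : MulAut F2) : autMat e⁻¹ * autMat e = 1 ∧ autMat e * autMat e⁻¹ = 1 := by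
    simp [← autMat_mul, autMat_one]
  have hμe : autMat μ = autMat (e₁⁻¹ * e₂⁻¹) := by
    calc autMat μ = (autMat e₁⁻¹ * autMat e₁) * autMat μ * (autMat e₂ * autMat e₂⁻¹) := by
          simp [hinv]
      _ = autMat e₁⁻¹ * (autMat e₁ * autMat μ * autMat e₂) * autMat e₂⁻¹ := by
          simp only [mul_assoc]
      _ = _ := by rw [hmat, mul_one, autMat_mul]
  have hsum := sum_abs_autMat_of_mem_closure (mul_mem (inv_mem k₁) (inv_mem k₂))
  obtain ⟨hnn, -, rfl | h3⟩ := autMat_mem_closure_nonneg hμ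
  · refine ⟨w, ?_⟩
    rw [mul_one e₁, eq_one_of_autMat_eq_one_of_mem_closure (mul_mem k₁ k₂), mul_one]
    simpa [autMat_one, autMat_mul] using hmat
  · rw [← hμe] at hsum
    simp only [abs_of_nonneg (hnn _ _)] at hsum
    omega

/-- The monodromy of the origami `L(2,3)`. -/
def monodromyL : F2 →* Equiv.Perm (Fin 4) :=
  FreeGroup.lift ![c[0, 1, 2], c[0, 3]]

theorem monodromyL_apply_zero {u : F2} (hu : u ∈ UL) : monodromyL u 0 = 0 := by
  have hx : monodromyL xg = c[0, 1, 2] := by simp [monodromyL, xg]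
  have hy : monodromyL yg = c[0, 3] := by simp [monodromyL, yg]
  suffices UL ≤ (MulAction.stabilizer (Equiv.Perm (Fin 4)) (0 : Fin 4)).comap monodromyL from
    this hu
  rw [UL, Subgroup.closure_le]
  rintro _ (rfl | rfl | rfl | rfl | rfl) <;>
    simp only [SetLike.mem_coe, Subgroup.mem_comap, MulAction.mem_stabilizer_iff, map_mul, map_pow,
      map_inv, hx, hy] <;> decide

theorem perm_fin_four_pow (p : Equiv.Perm (Fin 4)) : p ^ 12 = 1 := by
  revert p
  decide +kernel

theorem perm_fin_four_zpow_congr (p : Equiv.Perm (Fin 4)) {a b : ℤ} (h : a ≡ b [ZMOD 12]) :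
    p ^ a = p ^ b := by
  obtain ⟨c, hc⟩ := h.dvd
  rw [← sub_add_cancel b a, hc, zpow_add, zpow_mul, zpow_ofNat,
    perm_fin_four_pow, one_zpow, one_mul]

/-- The automorphism `x ↦ x * y ^ k`, `y ↦ y`. -/
def lowerShearAut (k : ℤ) : MulAut F2 := swapAut * shearAut k * swapAut

@[simp] theorem lowerShearAut_x (k : ℤ) : lowerShearAut k xg = xg * yg ^ k := by
  simp [lowerShearAut]

@[simp] theorem lowerShearAut_y (k : ℤ) : lowerShearAut k yg = yg := by simp [lowerShearAut]

theorem autMat_lowerShearAut (k : ℤ) : autMat (lowerShearAut k) = !![1, 0; k, 1] := by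
  simp [lowerShearAut, autMat_mul, autMat_shearAut, autMat_swapAut]

/-- The commutator of an upper and a lower shear. -/
def shearComm (a b : ℤ) : MulAut F2 :=
  shearAut a * lowerShearAut b * shearAut (-a) * lowerShearAut (-b)

theorem monodromyL_shearComm {a b : ℤ} (ha : a ≡ 4 [ZMOD 12]) (hb : b ≡ 9 [ZMOD 12]) :
    (monodromyL (shearComm a b xg) = c[0, 1, 2]) ∧
      (monodromyL (shearComm a b yg) = c[0, 1, 2, 3]) := by
  have hx : monodromyL xg = c[0, 1, 2] := by simp [monodromyL, xg]
  have hy : monodromyL yg = c[0, 3] := by simp [monodromyL, yg]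
  have hQ : (c[0, 3] * c[0, 1, 2] ^ (4 : ℤ) : Equiv.Perm (Fin 4)) = c[0, 1, 2, 3] := by
    decide
  have hP : (c[0, 1, 2] * c[0, 1, 2, 3] ^ (9 : ℤ) : Equiv.Perm (Fin 4)) = c[0, 2, 3, 1] := by
    decide +kernel
  have hP' : (c[0, 2, 3, 1] ^ (-4 : ℤ) : Equiv.Perm (Fin 4)) = 1 := by decide
  have hQ' : (c[0, 2, 3, 1] * c[0, 1, 2, 3] ^ (-9 : ℤ) : Equiv.Perm (Fin 4)) = c[0, 1, 2] := by
    decide +kernel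
  simp only [shearComm, MulAut.mul_apply, lowerShearAut_x, lowerShearAut_y, shearAut_x, shearAut_y,
    map_mul, map_zpow, hx, hy, perm_fin_four_zpow_congr _ ha, perm_fin_four_zpow_congr _ hb,
    perm_fin_four_zpow_congr _ ha.neg, perm_fin_four_zpow_congr _ hb.neg, hQ, hP, hP', hQ', mul_one,
    and_self]

theorem exists_exponents {n : ℕ} (hn : 1 ≤ n) :
    ∃ a b : ℤ, a ≡ 4 [ZMOD 12] ∧ b ≡ 9 [ZMOD 12] ∧ (n : ℤ) ∣ a * b := by
  obtain ⟨e, m, hm, rfl⟩ := Nat.exists_eq_pow_mul_and_not_dvd (Nat.one_le_iff_ne_zero.1 hn) 3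
    (by norm_num)
  refine ⟨4 * m ^ 2, 9 ^ (e + 1), ?_, ?_, ?_⟩
  · have h3 : (m : ℤ) ^ 2 ≡ 1 [ZMOD 3] := by
      have : (m : ℤ) % 3 = 1 ∨ (m : ℤ) % 3 = 2 := by omega
      rcases this with h | h
      · simpa using Int.ModEq.pow (n := 3) (b := 1) 2 h
      · simpa using (Int.ModEq.pow (n := 3) (b := 2) 2 h).trans (by decide)
    simpa using h3.mul_left' (c := 4)
  · clear hn
    induction e with
    | zero => decide
    | succ e ih =>
      rw [pow_succ]
      exact (ih.mul_right 9).trans (by decide)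
  · refine ⟨4 * m * 3 ^ (e + 2), ?_⟩
    have : (9 : ℤ) = 3 ^ 2 := by norm_num
    push_cast
    rw [this, ← pow_mul]
    ring

theorem autMat_shearComm_mem_Gamma {n : ℕ} {a b : ℤ} (h : (n : ℤ) ∣ a * b) :
    ∃ A ∈ CongruenceSubgroup.Gamma n, (A : Matrix (Fin 2) (Fin 2) ℤ) = autMat (shearComm a b) := by
  have hA : autMat (shearComm a b) =
      !![1 + a * b + (a * b) ^ 2, -(a * (a * b)); b * (a * b), 1 - a * b] := by
    ext i j
    fin_cases i <;> fin_cases j <;>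
      simp [shearComm, autMat_mul, autMat_shearAut, autMat_lowerShearAut] <;> ring
  have hdet : (autMat (shearComm a b)).det = 1 := by
    rw [hA, Matrix.det_fin_two_of]
    ring
  refine ⟨⟨autMat (shearComm a b), hdet⟩, CongruenceSubgroup.Gamma_mem.2 ?_, rfl⟩
  have h0 : (a : ZMod n) * b = 0 := by
    exact_mod_cast (ZMod.intCast_zmod_eq_zero_iff_dvd (a * b) n).2 h
  simp [hA, h0]

theorem not_forall_stabilizes_of_shearComm {a b : ℤ} (ha : a ≡ 4 [ZMOD 12])
    (hb : b ≡ 9 [ZMOD 12]) (w : F2) : ¬ ∀ u ∈ UL, w * shearComm a b u * w⁻¹ ∈ UL := by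
  intro h
  obtain ⟨hx, hy⟩ := monodromyL_shearComm ha hb
  have fixes (u : F2) (hu : u ∈ UL) :
      monodromyL (shearComm a b u) ((monodromyL w)⁻¹ 0) = (monodromyL w)⁻¹ 0 := by
    have := monodromyL_apply_zero (h u hu)
    rw [map_mul, map_mul, map_inv, Equiv.Perm.mul_apply, Equiv.Perm.mul_apply] at this
    exact (Equiv.Perm.eq_inv_iff_eq).2 this
  have h₁ := fixes (xg * yg * xg⁻¹) (Subgroup.subset_closure (by simp))
  have h₂ := fixes (yg ^ 2) (Subgroup.subset_closure (by simp))
  have h₃ := fixes (xg ^ 3) (Subgroup.subset_closure (by simp))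
  have h₄ := fixes (yg * xg * yg⁻¹) (Subgroup.subset_closure (by simp))
  simp only [map_mul, map_pow, map_inv, hx, hy] at h₁ h₂ h₃ h₄
  generalize (monodromyL w)⁻¹ 0 = k at h₁ h₂ h₃ h₄
  clear fixes
  revert k
  decide
/-- The Veech group `Γ(U_L)` of the origami `L(2,3)` is not a congruence subgroup of
`SL₂(ℤ)`. -/
theorem veech_UL_not_congruence : ¬ IsCongruenceSet (VeechGroup UL) := by
  rintro ⟨n, hn, h⟩
  obtain ⟨a, b, ha, hb, hab⟩ := exists_exponents hn
  obtain ⟨A, hA, hAmat⟩ := autMat_shearComm_mem_Gamma hab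
  obtain ⟨γ, ⟨-, hγ⟩, hγA⟩ := h hA
  have h1 : autMat ((γ : MulAut F2) * (shearComm a b)⁻¹) = 1 := by
    rw [autMat_mul, ← hγA, hAmat, ← autMat_mul, mul_inv_cancel, autMat_one]
  obtain ⟨w, hw⟩ := exists_eq_conj_of_autMat_eq_one h1
  refine not_forall_stabilizes_of_shearComm ha hb w fun u hu => ?_
  rw [← MulAut.conj_apply, ← MulAut.mul_apply, ← hw, inv_mul_cancel_right]
  exact hγ.le ⟨u, hu, rfl⟩
end

section
/- Let Γ be a subgroup of SL₂(ℤ) containing the matrices A₁ = [[1,3],[0,1]] and A₆ = [[7,2],[−18,−5]] but not containing T = [[1,1],[0,1]]. Then the principal congruence subgroup Γ(60) is not contained in Γ. -/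
/-- The matrix `A₁ = [[1,3],[0,1]]` as an element of `SL₂(ℤ)`. -/
def A1mat : SL2Z := ⟨!![1, 3; 0, 1], by norm_num [Matrix.det_fin_two_of]⟩

/-- The matrix `A₆ = [[7,2],[-18,-5]]` as an element of `SL₂(ℤ)`. -/
def A6mat : SL2Z := ⟨!![7, 2; -18, -5], by norm_num [Matrix.det_fin_two_of]⟩

/-- The matrix `T = [[1,1],[0,1]]` as an element of `SL₂(ℤ)`. -/
def Tmat : SL2Z := ⟨!![1, 1; 0, 1], by norm_num [Matrix.det_fin_two_of]⟩

/-- If a subgroup `Γ` of `SL₂(ℤ)` contains `A₁` and `A₆` but not `T`, then the principal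
congruence subgroup `Γ(60)` is not contained in `Γ`. -/
theorem gamma60_not_le (Γ : Subgroup SL2Z) (h1 : A1mat ∈ Γ) (h6 : A6mat ∈ Γ)
    (hT : Tmat ∉ Γ) : ¬ CongruenceSubgroup.Gamma 60 ≤ Γ := by
  intro h
  -- `A₆` is parabolic: `A₆ ^ 20` is trivial modulo `20` and `T` modulo `3`.
  have hmem : A1mat ^ 7 * A6mat ^ 20 * Tmat⁻¹ ∈ CongruenceSubgroup.Gamma 60 := by
    rw [CongruenceSubgroup.Gamma_mem]
    decide +kernel
  refine hT ?_
  have hquot := Γ.mul_mem (Γ.inv_mem (h hmem)) (Γ.mul_mem (Γ.pow_mem h1 7) (Γ.pow_mem h6 20))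
  rwa [mul_inv_rev, inv_inv, inv_mul_cancel_right] at hquot
end

section
/- Let U be a finite index subgroup of F₂ satisfying Property B. Then for every n ∈ ℕ ∪ {0}, Stab(Hₙ) ⊆ Stab(U) as subgroups of Aut⁺(F₂). -/
/-- `Hₙ` is normal in `U`. -/
lemma le_normalizer_Hgrp {U : Subgroup F2} (α : U →* Multiplicative ℤ) (n : ℕ) :
    U ≤ Subgroup.normalizer (Hgrp α n : Set F2) := by
  have h := Subgroup.le_normalizer_map (H := Subgroup.comap α (divSub (n : ℤ))) U.subtype
  rwa [Subgroup.normalizer_eq_top, ← MonoidHom.range_eq_map, U.range_subtype] at h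

/-- `H₀` is contained in every `Hₙ`. -/
lemma Hgrp_zero_le {U : Subgroup F2} (α : U →* Multiplicative ℤ) (n : ℕ) :
    Hgrp α 0 ≤ Hgrp α n :=
  Subgroup.map_mono (Subgroup.comap_mono fun _ ha => (Int.natCast_dvd_natCast.mpr
    (dvd_zero n)).trans ha)

/-- Every `Hₙ` is a subgroup of `U`. -/
lemma Hgrp_le {U : Subgroup F2} (α : U →* Multiplicative ℤ) (n : ℕ) : Hgrp α n ≤ U :=
  Subgroup.map_subtype_le _

/-- Under Property B, the normalizer of `Hₙ` in `F₂` is `U`. -/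
lemma normalizer_Hgrp {U : Subgroup F2} (α : U →* Multiplicative ℤ)
    (hB : ∀ w : F2, w ∉ U → ¬ ∀ h ∈ Hgrp α 0, w * h * w⁻¹ ∈ U) (n : ℕ) :
    Subgroup.normalizer (Hgrp α n : Set F2) = U := by
  refine le_antisymm (fun w hw => ?_) (le_normalizer_Hgrp α n)
  by_contra hwU
  exact hB w hwU fun h hh =>
    Hgrp_le α n ((Subgroup.mem_normalizer_iff.mp hw h).mp (Hgrp_zero_le α n hh))

/-- Setting A with Property B: for every `n ∈ ℕ ∪ {0}`, `Stab(Hₙ) ⊆ Stab(U)` inside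
`Aut⁺(F₂)`. -/
theorem stab_Hn_subset_stab_U
    (k : ℕ) (hk : 2 ≤ k) (U : Subgroup F2) (hfin : U.FiniteIndex)
    (g : Fin k → F2)
    -- `g` is a free basis of `U`:
    (hgen : Subgroup.closure (Set.range g) = U)
    (hfree : Function.Injective ⇑(FreeGroup.lift g : FreeGroup (Fin k) →* F2))
    (hgU : ∀ j, g j ∈ U)
    -- `α : U → ℤ` is the homomorphism with `α(g₁) = 1` and `α(gⱼ) = 0` for `j ≥ 2`:
    (α : U →* Multiplicative ℤ)
    (hα0 : α ⟨g ⟨0, by omega⟩, hgU _⟩ = Multiplicative.ofAdd 1)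
    (hαj : ∀ j : Fin k, j ≠ ⟨0, by omega⟩ → α ⟨g j, hgU j⟩ = 1)
    -- Property B:
    (hB : ∀ w : F2, w ∉ U → ¬ ∀ h ∈ Hgrp α 0, w * h * w⁻¹ ∈ U)
    : ∀ n : ℕ, StabSet (Hgrp α n) ⊆ StabSet U := by
  rintro n γ ⟨hdet, hγ⟩
  refine ⟨hdet, ?_⟩
  rw [← normalizer_Hgrp α hB n]
  exact (Subgroup.map_equiv_normalizer_eq _ γ).trans (by rw [hγ])
end

section
/- Let U be a finite index subgroup of F₂ satisfying Property B. Then for every n ≥ 1: Stab(H₀) ⊆ Stab(Hₙ) and Γ(H₀) ⊆ Γ(Hₙ). -/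
theorem mem_Hgrp {U : Subgroup F2} {α : U →* Multiplicative ℤ} {n : ℕ} {w : F2} :
    w ∈ Hgrp α n ↔ ∃ hw : w ∈ U, (n : ℤ) ∣ Multiplicative.toAdd (α ⟨w, hw⟩) := by
  constructor
  · rintro ⟨u, hu, rfl⟩
    exact ⟨u.2, hu⟩
  · rintro ⟨hw, h⟩
    exact ⟨⟨w, hw⟩, h, rfl⟩

theorem mem_Hgrp_zero {U : Subgroup F2} {α : U →* Multiplicative ℤ} {w : F2} :
    w ∈ Hgrp α 0 ↔ ∃ hw : w ∈ U, α ⟨w, hw⟩ = 1 := by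
  rw [mem_Hgrp]
  simp only [Nat.cast_zero, zero_dvd_iff, toAdd_eq_zero]

/-- Since `U` normalizes `H₀`, Property B makes every automorphism preserving `H₀` map `U` into
`U`. -/
theorem apply_mem_of_map_Hgrp_zero {U : Subgroup F2} {α : U →* Multiplicative ℤ}
    (hB : ∀ w : F2, w ∉ U → ¬ ∀ h ∈ Hgrp α 0, w * h * w⁻¹ ∈ U)
    {γ : F2 ≃* F2} (hγ : Subgroup.map γ.toMonoidHom (Hgrp α 0) = Hgrp α 0)
    {u : F2} (hu : u ∈ U) : γ u ∈ U := by
  by_contra hw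
  refine hB _ hw fun h hh => ?_
  rw [← hγ] at hh
  obtain ⟨v, hv, rfl⟩ := hh
  obtain ⟨hvU, hv1⟩ := mem_Hgrp_zero.1 hv
  have hconj : u * v * u⁻¹ ∈ Hgrp α 0 := by
    refine mem_Hgrp_zero.2 ⟨U.mul_mem (U.mul_mem hu hvU) (U.inv_mem hu), ?_⟩
    change α (⟨u, hu⟩ * ⟨v, hvU⟩ * ⟨u, hu⟩⁻¹) = 1
    rw [map_mul, map_mul, hv1, mul_one, map_inv, mul_inv_cancel]
  have hmap : γ (u * v * u⁻¹) ∈ Hgrp α 0 := hγ ▸ Subgroup.mem_map_of_mem γ.toMonoidHom hconj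
  obtain ⟨hU, -⟩ := mem_Hgrp_zero.1 hmap
  simpa using hU

/-- Every element of `Hₙ` is an `n`-th power of an element of `U` times an element of `H₀`. -/
theorem map_Hgrp_le {U : Subgroup F2} {α : U →* Multiplicative ℤ}
    (hB : ∀ w : F2, w ∉ U → ¬ ∀ h ∈ Hgrp α 0, w * h * w⁻¹ ∈ U)
    {t : U} (ht : α t = Multiplicative.ofAdd 1)
    {γ : F2 ≃* F2} (hγ : Subgroup.map γ.toMonoidHom (Hgrp α 0) = Hgrp α 0) (n : ℕ) :
    Subgroup.map γ.toMonoidHom (Hgrp α n) ≤ Hgrp α n := by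
  rintro _ ⟨u, hu, rfl⟩
  obtain ⟨huU, m, hm⟩ := mem_Hgrp.1 hu
  set s : U := t ^ m with hs
  have hαs : α s = Multiplicative.ofAdd m := by
    rw [hs, map_zpow, ht, ← ofAdd_zsmul, smul_eq_mul, mul_one]
  have hv : (((s ^ n)⁻¹ * ⟨u, huU⟩ : U) : F2) ∈ Hgrp α 0 := by
    refine mem_Hgrp_zero.2 ⟨Subtype.property _, ?_⟩
    change α ((s ^ n)⁻¹ * ⟨u, huU⟩) = 1
    apply Multiplicative.toAdd.injective
    rw [map_mul, map_inv, map_pow, hαs, toAdd_mul, hm]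
    simp
  have hmap : γ (((s ^ n)⁻¹ * ⟨u, huU⟩ : U) : F2) ∈ Hgrp α 0 :=
    hγ ▸ Subgroup.mem_map_of_mem γ.toMonoidHom hv
  obtain ⟨hvU, hv1⟩ := mem_Hgrp_zero.1 hmap
  have hsU : γ s ∈ U := apply_mem_of_map_Hgrp_zero hB hγ s.2
  have huU' : γ u ∈ U := apply_mem_of_map_Hgrp_zero hB hγ huU
  have hdecomp : (⟨γ u, huU'⟩ : U) = ⟨γ s, hsU⟩ ^ n * ⟨_, hvU⟩ := by
    apply Subtype.ext
    simp
  refine mem_Hgrp.2 ⟨huU', ?_⟩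
  change (n : ℤ) ∣ Multiplicative.toAdd (α ⟨γ u, huU'⟩)
  rw [hdecomp, map_mul, hv1, mul_one, map_pow, toAdd_pow, nsmul_eq_mul]
  exact dvd_mul_right _ _

theorem map_symm_eq {G : Type*} [Group G] {H : Subgroup G} {γ : G ≃* G}
    (hγ : Subgroup.map γ.toMonoidHom H = H) : Subgroup.map γ.symm.toMonoidHom H = H := by
  conv_lhs => rw [← hγ]
  rw [Subgroup.map_map]
  convert Subgroup.map_id H
  ext x
  simp

theorem map_Hgrp_eq {U : Subgroup F2} {α : U →* Multiplicative ℤ}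
    (hB : ∀ w : F2, w ∉ U → ¬ ∀ h ∈ Hgrp α 0, w * h * w⁻¹ ∈ U)
    {t : U} (ht : α t = Multiplicative.ofAdd 1)
    {γ : F2 ≃* F2} (hγ : Subgroup.map γ.toMonoidHom (Hgrp α 0) = Hgrp α 0) (n : ℕ) :
    Subgroup.map γ.toMonoidHom (Hgrp α n) = Hgrp α n := by
  refine le_antisymm (map_Hgrp_le hB ht hγ n) fun w hw => ?_
  exact ⟨γ.symm w, map_Hgrp_le hB ht (map_symm_eq hγ) n
    (Subgroup.mem_map_of_mem γ.symm.toMonoidHom hw), γ.apply_symm_apply w⟩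

/-- Setting A with Property B: for every `n ≥ 1`, `Stab(H₀) ⊆ Stab(Hₙ)` and
`Γ(H₀) ⊆ Γ(Hₙ)`. -/
theorem stab_H0_subset_stab_Hn
    (k : ℕ) (hk : 2 ≤ k) (U : Subgroup F2) (hfin : U.FiniteIndex)
    (g : Fin k → F2)
    -- `g` is a free basis of `U`:
    (hgen : Subgroup.closure (Set.range g) = U)
    (hfree : Function.Injective ⇑(FreeGroup.lift g : FreeGroup (Fin k) →* F2))
    (hgU : ∀ j, g j ∈ U)
    -- `α : U → ℤ` is the homomorphism with `α(g₁) = 1` and `α(gⱼ) = 0` for `j ≥ 2`: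
    (α : U →* Multiplicative ℤ)
    (hα0 : α ⟨g ⟨0, by omega⟩, hgU _⟩ = Multiplicative.ofAdd 1)
    (hαj : ∀ j : Fin k, j ≠ ⟨0, by omega⟩ → α ⟨g j, hgU j⟩ = 1)
    -- Property B:
    (hB : ∀ w : F2, w ∉ U → ¬ ∀ h ∈ Hgrp α 0, w * h * w⁻¹ ∈ U)
    : ∀ n : ℕ, 1 ≤ n →
      StabSet (Hgrp α 0) ⊆ StabSet (Hgrp α n) ∧
      VeechGroup (Hgrp α 0) ⊆ VeechGroup (Hgrp α n) := by
  intro n _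
  have hstab : StabSet (Hgrp α 0) ⊆ StabSet (Hgrp α n) :=
    fun γ hγ => ⟨hγ.1, map_Hgrp_eq hB hα0 hγ.2 n⟩
  exact ⟨hstab, fun A ⟨γ, hγ, hA⟩ => ⟨γ, hstab hγ, hA⟩⟩
end
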